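/- arXiv:1706.03740 — 2 statements merged into one kernel-verified Lean document; each statement's English description precedes it below -/
import Mathlib

section
/- Correlation inequality (binary case). For all κ,ε ∈ (0,1) there exist δ₀ > 0 and n₀ ∈ ℕ such that for all n ≥ n₀ and δ ∈ (0,δ₀] the following holds. Let μ_q be a κ-bounded product measure on ({0,1}×{0,1})ⁿ both of whose marginals equal the product measure μ_p on {0,1}ⁿ. If 𝒜 ⊆ {0,1}ⁿ satisfies μ_p(𝒜) > (1−δ)ⁿ, then μ_q(𝒜 × 𝒜) > (1−ε)ⁿ. -/
open Finset

noncomputable section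

/-- Product measure on `Jⁿ` from weights `p`. -/
def prodMeas {n : ℕ} {J : Type*} (p : Fin n → J → ℝ) (a : Fin n → J) : ℝ :=
  ∏ i, p i (a i)

/-- Measure of a set under a (finitely supported) measure `μ`. -/
noncomputable def smeas {α : Type*} [Fintype α] (μ : α → ℝ) (A : Set α) : ℝ :=
  ∑ x, A.indicator μ x

/-- If a nonnegative function has mean one and is at most `1 + d`, then it deviates from one
by at most `d / κ`, where `κ` bounds the weights from below. -/
lemma abs_sub_one_le_of_mean_one {X : Type*} [Fintype X] {q a : X → ℝ} {κ d : ℝ}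
    (hκ0 : 0 < κ) (hκ : ∀ x, κ ≤ q x) (hq : ∑ x, q x = 1)
    (ha1 : ∑ x, q x * a x = 1) (had : ∀ x, a x - 1 ≤ d) (x : X) :
    |a x - 1| ≤ d / κ := by
  have hq0 : ∀ y, 0 < q y := fun y => hκ0.trans_le (hκ y)
  have hsum : ∑ y, q y * (d - (a y - 1)) = d := by
    have : ∀ y, q y * (d - (a y - 1)) = (d + 1) * q y - q y * a y := fun y => by ring
    simp only [this, sum_sub_distrib, ← mul_sum, hq, ha1]
    ring
  have hx : q x * (d - (a x - 1)) ≤ d := by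
    refine le_of_le_of_eq (single_le_sum (f := fun y => q y * (d - (a y - 1))) ?_ (mem_univ x)) hsum
    exact fun y _ => mul_nonneg (hq0 y).le (sub_nonneg.2 (had y))
  have hκx : κ * (d - (a x - 1)) ≤ d :=
    (mul_le_mul_of_nonneg_right (hκ x) (sub_nonneg.2 (had x))).trans hx
  have hqx : q x ≤ 1 := hq ▸ single_le_sum (fun y _ => (hq0 y).le) (mem_univ x)
  have hd0 : 0 ≤ d :=
    (mul_nonneg (hq0 x).le (sub_nonneg.2 (had x))).trans hx
  have hdk : d ≤ d / κ := by
    rw [le_div_iff₀ hκ0]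
    exact mul_le_of_le_one_right hd0 ((hκ x).trans hqx)
  have hkx : d - (a x - 1) ≤ d / κ := by
    rw [le_div_iff₀ hκ0]
    linarith
  rw [abs_le]
  constructor <;> linarith [had x]

lemma exists_one_le_of_mean_one {X : Type*} [Fintype X] {q b : X → ℝ}
    (hq0 : ∀ x, 0 < q x) (hq : ∑ x, q x = 1) (hb1 : ∑ x, q x * b x = 1) :
    ∃ x, 1 ≤ b x := by
  by_contra! h
  rcases isEmpty_or_nonempty X with hX | hX
  · simp at hq
  · have := sum_lt_sum_of_nonempty (univ_nonempty (α := X))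
      (fun x _ => mul_lt_of_lt_one_right (hq0 x) (h x))
    linarith

lemma one_le_sum_of_large {X : Type*} [Fintype X] {q f : X → ℝ} {κ : ℝ} {C : ℕ}
    (hκ0 : 0 < κ) (hκ : ∀ x, κ ≤ q x) (hf : ∀ x, 0 ≤ f x) (hC : 0 < C)
    {x : X} (hx : 1 / (κ * C) ≤ f x - 1) :
    1 ≤ ∑ y, q y * f y ^ C := by
  have hC' : (0 : ℝ) < C := Nat.cast_pos.2 hC
  have hbern := one_add_mul_le_pow (show (-2 : ℝ) ≤ f x - 1 by linarith [hf x]) C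
  rw [add_sub_cancel] at hbern
  have hx' : 1 ≤ κ * (C * (f x - 1)) := by
    rw [div_le_iff₀ (by positivity)] at hx
    linarith
  have hterm : q x * f x ^ C ≤ ∑ y, q y * f y ^ C :=
    single_le_sum (f := fun y => q y * f y ^ C)
      (fun y _ => mul_nonneg (hκ0.le.trans (hκ y)) (pow_nonneg (hf y) C)) (mem_univ x)
  have : κ * f x ^ C ≤ q x * f x ^ C := mul_le_mul_of_nonneg_right (hκ x) (pow_nonneg (hf x) C)
  nlinarith

/-- One-coordinate reverse hypercontractive inequality with a loss of `1 - ε`, normalized. -/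
lemma one_sub_le_sum_mul_pow_of_mean_one {J J' : Type*} [Fintype J] [Fintype J']
    {q : J × J' → ℝ} {κ ε : ℝ} {C : ℕ} (hκ0 : 0 < κ) (hε : 0 ≤ ε) (hκ : ∀ x, κ ≤ q x)
    (hq : ∑ x, q x = 1) {a : J → ℝ} {b : J' → ℝ} (ha : ∀ j, 0 ≤ a j) (hb : ∀ j, 0 ≤ b j)
    (ha1 : ∑ x, q x * a x.1 = 1) (hb1 : ∑ x, q x * b x.2 = 1)
    (hC0 : 0 < C) (hC : 1 ≤ κ ^ 4 * ε * C) :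
    1 - ε ≤ ∑ x, q x * (a x.1 * b x.2) ^ C := by
  have hq0 : ∀ y, 0 < q y := fun y => hκ0.trans_le (hκ y)
  have hC' : (0 : ℝ) < C := Nat.cast_pos.2 hC0
  have hab : ∀ x : J × J', 0 ≤ a x.1 * b x.2 := fun x => mul_nonneg (ha _) (hb _)
  by_cases hal : ∃ j, 1 / (κ * C) ≤ a j - 1
  · obtain ⟨j, hj⟩ := hal
    obtain ⟨x, hx⟩ := exists_one_le_of_mean_one hq0 hq hb1
    have := one_le_sum_of_large (f := fun x => a x.1 * b x.2) hκ0 hκ hab hC0 (x := (j, x.2))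
      (by dsimp only; nlinarith [ha j])
    linarith
  by_cases hbl : ∃ j, 1 / (κ * C) ≤ b j - 1
  · obtain ⟨j, hj⟩ := hbl
    obtain ⟨x, hx⟩ := exists_one_le_of_mean_one hq0 hq ha1
    have := one_le_sum_of_large (f := fun x => a x.1 * b x.2) hκ0 hκ hab hC0 (x := (x.1, j))
      (by dsimp only; nlinarith [hb j])
    linarith
  push Not at hal hbl
  have hda := abs_sub_one_le_of_mean_one (a := fun x : J × J' => a x.1) hκ0 hκ hq ha1
    (fun x => (hal x.1).le)
  have hdb := abs_sub_one_le_of_mean_one (a := fun x : J × J' => b x.2) hκ0 hκ hq hb1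
    (fun x => (hbl x.2).le)
  have hsmall : C * (1 / (κ * C) / κ) ^ 2 ≤ ε := by
    have : C * (1 / (κ * C) / κ) ^ 2 = 1 / (κ ^ 4 * C) := by field_simp
    rw [this, div_le_iff₀ (by positivity)]
    linarith
  set h := 1 / (κ * C) / κ
  have hterm : ∀ x : J × J', q x * (1 + C * ((a x.1 - 1) + (b x.2 - 1)) - ε) ≤
      q x * (a x.1 * b x.2) ^ C := by
    intro x
    refine mul_le_mul_of_nonneg_left ?_ (hq0 x).le
    have hbern := one_add_mul_le_pow (show (-2 : ℝ) ≤ a x.1 * b x.2 - 1 by linarith [hab x]) C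
    rw [add_sub_cancel] at hbern
    have hprod : |(a x.1 - 1) * (b x.2 - 1)| ≤ h ^ 2 := by
      rw [abs_mul, sq]
      exact mul_le_mul (hda x) (hdb x) (abs_nonneg _) ((abs_nonneg _).trans (hda x))
    have := mul_le_mul_of_nonneg_left (neg_le_of_abs_le hprod) hC'.le
    linarith
  refine le_trans (le_of_eq ?_) (sum_le_sum fun x _ => hterm x)
  have : ∀ x : J × J', q x * (1 + C * ((a x.1 - 1) + (b x.2 - 1)) - ε) =
      (1 - ε - 2 * C) * q x + C * (q x * a x.1) + C * (q x * b x.2) := fun x => by ring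
  simp only [this, sum_add_distrib, ← mul_sum, hq, ha1, hb1]
  ring

/-- One-coordinate reverse hypercontractive inequality with a loss of `1 - ε`. -/
lemma one_sub_mul_pow_le_sum_mul_pow {J J' : Type*} [Fintype J] [Fintype J']
    {q : J × J' → ℝ} {κ ε : ℝ} {C : ℕ} (hκ0 : 0 < κ) (hε : 0 ≤ ε) (hκ : ∀ x, κ ≤ q x)
    (hq : ∑ x, q x = 1) {a : J → ℝ} {b : J' → ℝ} (ha : ∀ j, 0 ≤ a j) (hb : ∀ j, 0 ≤ b j)
    (hC0 : 0 < C) (hC : 1 ≤ κ ^ 4 * ε * C) :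
    (1 - ε) * ((∑ x, q x * a x.1) * ∑ x, q x * b x.2) ^ C ≤
      ∑ x, q x * (a x.1 * b x.2) ^ C := by
  have hq0 : ∀ y, 0 ≤ q y := fun y => hκ0.le.trans (hκ y)
  have hs : 0 ≤ ∑ x, q x * a x.1 := sum_nonneg fun x _ => mul_nonneg (hq0 x) (ha _)
  have ht : 0 ≤ ∑ x, q x * b x.2 := sum_nonneg fun x _ => mul_nonneg (hq0 x) (hb _)
  have hr : 0 ≤ ∑ x, q x * (a x.1 * b x.2) ^ C :=
    sum_nonneg fun x _ => mul_nonneg (hq0 x) (pow_nonneg (mul_nonneg (ha _) (hb _)) C)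
  set s := ∑ x, q x * a x.1
  set t := ∑ x, q x * b x.2
  rcases hs.eq_or_lt with hs0 | hs0
  · simpa [← hs0, hC0.ne'] using hr
  rcases ht.eq_or_lt with ht0 | ht0
  · simpa [← ht0, hC0.ne'] using hr
  have key := one_sub_le_sum_mul_pow_of_mean_one (a := fun j => a j / s) (b := fun j => b j / t)
    hκ0 hε hκ hq (fun j => div_nonneg (ha j) hs) (fun j => div_nonneg (hb j) ht)
    (by simp only [← mul_div_assoc, ← sum_div]; exact div_self hs0.ne')
    (by simp only [← mul_div_assoc, ← sum_div]; exact div_self ht0.ne') hC0 hC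
  have hscale : ∀ x : J × J', q x * (a x.1 / s * (b x.2 / t)) ^ C =
      q x * (a x.1 * b x.2) ^ C / (s * t) ^ C := fun x => by
    rw [div_mul_div_comm, div_pow, mul_div_assoc]
  simp only [hscale, ← sum_div] at key
  rwa [le_div_iff₀ (by positivity)] at key

lemma smeas_prodMeas_succ {n : ℕ} {J : Type*} [Fintype J] (p : Fin (n + 1) → J → ℝ)
    (A : Set (Fin (n + 1) → J)) :
    smeas (prodMeas p) A =
      ∑ j, p 0 j * smeas (prodMeas fun i => p i.succ) {x | Fin.cons j x ∈ A} := by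
  classical
  unfold smeas
  rw [← (Fin.consEquiv fun _ : Fin (n + 1) => J).sum_comp, Fintype.sum_prod_type]
  refine sum_congr rfl fun j _ => ?_
  rw [mul_sum]
  refine sum_congr rfl fun x _ => ?_
  simp [Set.indicator_apply, prodMeas, Fin.consEquiv, Fin.prod_univ_succ]

lemma smeas_prodMeas_nonneg {n : ℕ} {J : Type*} [Fintype J] {p : Fin n → J → ℝ}
    (hp : ∀ i j, 0 ≤ p i j) (A : Set (Fin n → J)) : 0 ≤ smeas (prodMeas p) A :=
  sum_nonneg fun x _ => Set.indicator_nonneg (fun y _ => prod_nonneg fun i _ => hp i (y i)) x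

/-- Reverse hypercontractive inequality for two sets, with a loss of `1 - ε` per coordinate. -/
lemma pow_mul_smeas_pow_le_smeas_prod {J J' : Type*} [Fintype J] [Fintype J'] {κ ε : ℝ} {C : ℕ}
    (hκ0 : 0 < κ) (hε : 0 ≤ ε) (hε1 : ε ≤ 1) (hC0 : 0 < C) (hC : 1 ≤ κ ^ 4 * ε * C)
    {n : ℕ} (q : Fin n → J × J' → ℝ) (hq : ∀ i, ∑ x, q i x = 1) (hκ : ∀ i x, κ ≤ q i x)
    (A : Set (Fin n → J)) (B : Set (Fin n → J')) :
    (1 - ε) ^ n * (smeas (prodMeas fun i j => ∑ j', q i (j, j')) A *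
        smeas (prodMeas fun i j' => ∑ j, q i (j, j')) B) ^ C ≤
      smeas (prodMeas q) {r | (fun i => (r i).1) ∈ A ∧ (fun i => (r i).2) ∈ B} := by
  classical
  have hq0 : ∀ i x, 0 ≤ q i x := fun i x => hκ0.le.trans (hκ i x)
  induction n with
  | zero =>
    simp only [smeas, prodMeas, univ_unique, sum_singleton, Set.indicator_apply, univ_eq_empty,
      prod_empty, Set.mem_ofPred_eq, pow_zero, one_mul]
    rw [Subsingleton.elim (fun i => ((default : Fin 0 → J × J') i).1) default,
      Subsingleton.elim (fun i => ((default : Fin 0 → J × J') i).2) default]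
    by_cases hA : default ∈ A <;> by_cases hB : default ∈ B <;> simp [hA, hB, hC0.ne']
  | succ n ih =>
    set a : J → ℝ := fun j =>
      smeas (prodMeas fun (i : Fin n) j => ∑ j', q i.succ (j, j')) {x | Fin.cons j x ∈ A} with ha
    set b : J' → ℝ := fun j =>
      smeas (prodMeas fun (i : Fin n) j' => ∑ j, q i.succ (j, j')) {x | Fin.cons j x ∈ B} with hb
    have ha0 : ∀ j, 0 ≤ a j := fun j =>
      smeas_prodMeas_nonneg (fun i j => sum_nonneg fun j' _ => hq0 _ _) _
    have hb0 : ∀ j, 0 ≤ b j := fun j =>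
      smeas_prodMeas_nonneg (fun i j => sum_nonneg fun j' _ => hq0 _ _) _
    have hone := one_sub_mul_pow_le_sum_mul_pow hκ0 hε (hκ 0) (hq 0) ha0 hb0 hC0 hC
    have hA : smeas (prodMeas fun i j => ∑ j', q i (j, j')) A = ∑ x, q 0 x * a x.1 := by
      rw [smeas_prodMeas_succ, Fintype.sum_prod_type]
      simp only [sum_mul, ha]
    have hB : smeas (prodMeas fun i j' => ∑ j, q i (j, j')) B = ∑ x, q 0 x * b x.2 := by
      rw [smeas_prodMeas_succ, Fintype.sum_prod_type_right]
      simp only [sum_mul, hb]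
    rw [hA, hB, smeas_prodMeas_succ, pow_succ, mul_assoc]
    refine (mul_le_mul_of_nonneg_left hone (pow_nonneg (sub_nonneg.2 hε1) n)).trans ?_
    rw [mul_sum]
    refine sum_le_sum fun x _ => ?_
    rw [mul_left_comm]
    refine mul_le_mul_of_nonneg_left ?_ (hq0 0 x)
    refine (ih (fun i => q i.succ) (fun i => hq _) (fun i => hκ _) _ _
      (fun i => hq0 _)).trans (le_of_eq ?_)
    congr 1
    ext r
    have h1 : (fun i => ((Fin.cons x r : Fin (n + 1) → J × J') i).1) =
        Fin.cons x.1 fun i => (r i).1 := by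
      ext i; cases i using Fin.cases <;> rfl
    have h2 : (fun i => ((Fin.cons x r : Fin (n + 1) → J × J') i).2) =
        Fin.cons x.2 fun i => (r i).2 := by
      ext i; cases i using Fin.cases <;> rfl
    simp only [Set.mem_ofPred_eq, h1, h2]

/-- **Correlation inequality (binary case).** For all `κ,ε ∈ (0,1)` there exist `δ₀ > 0`
and `n₀` such that for all `n ≥ n₀` and `δ ∈ (0,δ₀]`: if `μ_q` is a `κ`-bounded product
measure on `({0,1}×{0,1})ⁿ` with both marginals `μ_p`, and `𝒜 ⊆ {0,1}ⁿ` has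
`μ_p(𝒜) > (1−δ)ⁿ`, then `μ_q(𝒜 × 𝒜) > (1−ε)ⁿ`. -/
theorem correlation_inequality_binary :
    ∀ κ ∈ Set.Ioo (0:ℝ) 1, ∀ ε ∈ Set.Ioo (0:ℝ) 1,
    ∃ δ₀ > (0:ℝ), ∃ n₀ : ℕ, ∀ n, n₀ ≤ n → ∀ δ ∈ Set.Ioc (0:ℝ) δ₀,
    ∀ q : Fin n → Bool × Bool → ℝ,
      (∀ i, ∑ jj : Bool × Bool, q i jj = 1) →
      (∀ i jj, q i jj ∈ Set.Icc κ (1 - κ)) →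
    ∀ p : Fin n → Bool → ℝ,
      (∀ i j, ∑ j' : Bool, q i (j, j') = p i j) →
      (∀ i j, ∑ j' : Bool, q i (j', j) = p i j) →
    ∀ A : Set (Fin n → Bool),
      (1 - δ) ^ n < smeas (prodMeas p) A →
      (1 - ε) ^ n <
        smeas (prodMeas q)
          {r : Fin n → Bool × Bool | (fun i => (r i).1) ∈ A ∧ (fun i => (r i).2) ∈ A} := by
  intro κ hκ ε hε
  have hκ0 : 0 < κ := hκ.1
  have hε0 : 0 < ε := hε.1
  obtain ⟨C, hC⟩ := exists_nat_ge (1 / (κ ^ 4 * (ε / 2)))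
  have hC0' : (0 : ℝ) < C := lt_of_lt_of_le (by positivity) hC
  have hC0 : 0 < C := Nat.cast_pos.1 hC0'
  rw [div_le_iff₀ (by positivity)] at hC
  refine ⟨ε / (4 * C), by positivity, 1, fun n hn δ hδ q hq hqκ p hp hp' A hA => ?_⟩
  have hδ' : δ * (4 * C) ≤ ε := (le_div_iff₀ (by positivity)).1 hδ.2
  have hC1 : (1 : ℝ) ≤ C := Nat.one_le_cast.2 hC0
  have hδ1 : δ < 1 := by nlinarith [hε.2, hδ.1]
  have key := pow_mul_smeas_pow_le_smeas_prod (ε := ε / 2) hκ0 (by linarith)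
    (by linarith [hε.2]) hC0 (by linarith) q hq (fun i x => (hqκ i x).1) A A
  simp only [hp, hp'] at key
  refine lt_of_lt_of_le ?_ key
  have hpow : ((1 - δ) ^ n * (1 - δ) ^ n) ^ C <
      (smeas (prodMeas p) A * smeas (prodMeas p) A) ^ C := by
    have h0 : 0 < (1 - δ) ^ n := pow_pos (by linarith) n
    exact pow_lt_pow_left₀ (mul_lt_mul'' hA hA h0.le h0.le) (by positivity) hC0.ne'
  have hbern := one_add_mul_le_pow (show (-2 : ℝ) ≤ -δ by linarith) (2 * C)
  rw [← sub_eq_add_neg] at hbern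
  push_cast at hbern
  have hε2 : 0 < 1 - ε / 2 := by linarith [hε.2]
  calc (1 - ε) ^ n ≤ ((1 - ε / 2) * (1 - δ) ^ (2 * C)) ^ n := by
        refine pow_le_pow_left₀ (by linarith [hε.2]) ?_ n
        nlinarith
    _ = (1 - ε / 2) ^ n * ((1 - δ) ^ n * (1 - δ) ^ n) ^ C := by
        rw [mul_pow, ← pow_add, ← pow_mul, ← pow_mul]
        congr 2
        ring
    _ < _ := mul_lt_mul_of_pos_left hpow (pow_pos hε2 n)
end
end

section
/- Probabilistic forbidden intersection theorem. For all D,C,k ∈ ℕ there is θ₁ > 0 such that for all κ,γ,ε ∈ (0,θ₁) there is θ₂ > 0 such that for all ζ ∈ (0,θ₂) there exist δ₀ > 0 and n₀ such that for all n ≥ n₀ and δ ∈ (0,δ₀] the following holds. Let R ∈ ℤ^D with all R_d > 0 and max_d R_d < n^C, and suppose: (1) μ_q is a κ-bounded product measure on ({0,1}×{0,1})ⁿ with both marginals equal to μ_p; (2) 𝒱 = (v_i : i∈[n]) is an R-bounded family of vectors in ℤ^D that is γ-robustly (R,k)-generating; (3) w ∈ ℤ^D with ‖w − 𝒱_∩(μ_q)‖_R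 < ζn. Then every 𝒜 ⊆ {0,1}ⁿ with μ_p(𝒜) > (1−δ)ⁿ satisfies μ_q((𝒜 × 𝒜)^{𝒱_∩}_w) > (1−ε)ⁿ. -/
open Finset

noncomputable section

/-- The `R`-scaled sup-norm `max_d |v d| / R d`. -/
noncomputable def rnorm {D : ℕ} (R : Fin D → ℝ) (v : Fin D → ℝ) : ℝ :=
  ⨆ d, |v d| / R d

/-- The array `𝒱_∩` associated to a family of vectors `v`. -/
def capArr {n D : ℕ} (v : Fin n → Fin D → ℤ) (i : Fin n) (jj : Bool × Bool) (d : Fin D) : ℤ :=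
  if jj.1 ∧ jj.2 then v i d else 0

/-- Evaluation of an `(n,J)`-array at `a ∈ Jⁿ`. -/
def arrEval {n D : ℕ} {J : Type*} (V : Fin n → J → Fin D → ℤ)
    (a : Fin n → J) (d : Fin D) : ℤ :=
  ∑ i, V i (a i) d

/-- Expectation `𝒱(μ) d = E_{a∼μ} 𝒱(a) d`. -/
noncomputable def arrExp {n D : ℕ} {J : Type*} [Fintype J]
    (V : Fin n → J → Fin D → ℤ) (μ : (Fin n → J) → ℝ) (d : Fin D) : ℝ :=
  ∑ a : Fin n → J, μ a * (arrEval V a d : ℝ)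

/-- `v` is `γ`-robustly `(R,k)`-generating. -/
def RobustlyGenerating {n D : ℕ} (γ : ℝ) (R : Fin D → ℝ) (k : ℕ)
    (v : Fin n → Fin D → ℤ) : Prop :=
  ∀ u : Fin D → ℤ, rnorm R (fun d => (u d : ℝ)) ≤ 1 →
    ∀ T : Finset (Fin n), (T.card : ℝ) ≤ γ * n →
      ∃ S S' : Finset (Fin n), Disjoint S S' ∧ Disjoint S T ∧ Disjoint S' T ∧
        S.card + S'.card ≤ k ∧ ∀ d, u d = ∑ i ∈ S, v i d - ∑ i ∈ S', v i d

/-! ### Product measures on finite cubes -/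

section ProductMeasure

variable {n : ℕ} {J : Type*}

lemma prodMeas_nonneg {p : Fin n → J → ℝ} (hp : ∀ i j, 0 ≤ p i j) (a : Fin n → J) :
    0 ≤ prodMeas p a :=
  prod_nonneg fun i _ => hp i (a i)

lemma sum_prod_apply [Fintype J] (f : Fin n → J → ℝ) :
    ∑ a : Fin n → J, ∏ i, f i (a i) = ∏ i, ∑ j, f i j := by
  classical
  rw [Finset.prod_univ_sum, Fintype.piFinset_univ]

lemma sum_prodMeas [Fintype J] {p : Fin n → J → ℝ} (hp : ∀ i, ∑ j, p i j = 1) :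
    ∑ a, prodMeas p a = 1 := by
  simp only [prodMeas]
  rw [sum_prod_apply]
  exact prod_eq_one fun i _ => hp i

lemma smeas_nonneg {α : Type*} [Fintype α] {μ : α → ℝ} (hμ : ∀ x, 0 ≤ μ x) (A : Set α) :
    0 ≤ smeas μ A :=
  sum_nonneg fun x _ => Set.indicator_nonneg (fun x _ => hμ x) x

lemma smeas_mono {α : Type*} [Fintype α] {μ : α → ℝ} (hμ : ∀ x, 0 ≤ μ x) {A B : Set α}
    (h : A ⊆ B) : smeas μ A ≤ smeas μ B :=
  sum_le_sum fun x _ => Set.indicator_le_indicator_of_subset h hμ x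

lemma smeas_le_sum {α : Type*} [Fintype α] {μ : α → ℝ} (hμ : ∀ x, 0 ≤ μ x) (A : Set α) :
    smeas μ A ≤ ∑ x, μ x :=
  sum_le_sum fun x _ => Set.indicator_le_self' (fun x _ => hμ x) x

lemma smeas_union_add_inter {α : Type*} [Fintype α] (μ : α → ℝ) (A B : Set α) :
    smeas μ (A ∪ B) + smeas μ (A ∩ B) = smeas μ A + smeas μ B := by
  simp only [smeas, ← sum_add_distrib]
  exact sum_congr rfl fun x _ => congrFun (Set.indicator_union_add_inter μ A B) x

lemma smeas_union_le {α : Type*} [Fintype α] {μ : α → ℝ} (hμ : ∀ x, 0 ≤ μ x) (A B : Set α) :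
    smeas μ (A ∪ B) ≤ smeas μ A + smeas μ B := by
  have := smeas_union_add_inter μ A B
  have := smeas_nonneg hμ (A ∩ B)
  linarith

lemma smeas_iUnion_le {α ι : Type*} [Fintype α] [Fintype ι] {μ : α → ℝ} (hμ : ∀ x, 0 ≤ μ x)
    (A : ι → Set α) : smeas μ (⋃ i, A i) ≤ ∑ i, smeas μ (A i) := by
  classical
  simp only [smeas]
  rw [sum_comm]
  refine sum_le_sum fun x _ => ?_
  by_cases hx : x ∈ ⋃ i, A i
  · obtain ⟨i, hi⟩ := Set.mem_iUnion.1 hx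
    rw [Set.indicator_of_mem hx]
    calc μ x = (A i).indicator μ x := by rw [Set.indicator_of_mem hi]
      _ ≤ _ := single_le_sum (f := fun i => (A i).indicator μ x)
          (fun i _ => Set.indicator_nonneg (fun x _ => hμ x) x) (mem_univ i)
  · rw [Set.indicator_of_notMem hx]
    exact sum_nonneg fun i _ => Set.indicator_nonneg (fun x _ => hμ x) x

lemma smeas_compl_add {α : Type*} [Fintype α] (μ : α → ℝ) (A : Set α) :
    smeas μ A + smeas μ Aᶜ = ∑ x, μ x := by
  simp only [smeas, ← sum_add_distrib]
  exact sum_congr rfl fun x _ => congrFun (Set.indicator_self_add_compl A μ) x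

/-- Exponential Markov inequality. -/
lemma smeas_ge_le_exp {α : Type*} [Fintype α] {μ : α → ℝ} (hμ : ∀ x, 0 ≤ μ x) (f : α → ℝ)
    (t : ℝ) {s : ℝ} (hs : 0 ≤ s) :
    smeas μ {x | t ≤ f x} ≤ Real.exp (-(s * t)) * ∑ x, μ x * Real.exp (s * f x) := by
  rw [smeas, mul_sum]
  refine sum_le_sum fun x _ => ?_
  by_cases hx : t ≤ f x
  · rw [Set.indicator_of_mem (by exact hx)]
    have h1 : (1 : ℝ) ≤ Real.exp (-(s * t)) * Real.exp (s * f x) := by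
      rw [← Real.exp_add]
      exact Real.one_le_exp (by nlinarith)
    nlinarith [hμ x]
  · rw [Set.indicator_of_notMem (by exact hx)]
    have := hμ x
    positivity

lemma sum_prodMeas_mul_exp [Fintype J] (p : Fin n → J → ℝ) (g : Fin n → J → ℝ) :
    ∑ a, prodMeas p a * Real.exp (∑ i, g i (a i)) = ∏ i, ∑ j, p i j * Real.exp (g i j) := by
  rw [← sum_prod_apply]
  refine sum_congr rfl fun a _ => ?_
  rw [Real.exp_sum, prodMeas, prod_mul_distrib]

lemma sum_prodMeas_mul_apply [Fintype J] {p : Fin n → J → ℝ} (hp : ∀ i, ∑ j, p i j = 1)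
    (k : Fin n) (g : J → ℝ) :
    ∑ a, prodMeas p a * g (a k) = ∑ j, p k j * g j := by
  classical
  have h := sum_prod_apply (fun i j => p i j * if i = k then g j else 1)
  have h1 : ∀ a : Fin n → J, ∏ i, (p i (a i) * if i = k then g (a i) else 1)
      = prodMeas p a * g (a k) := by
    intro a
    rw [prod_mul_distrib, prodMeas]
    congr 1
    simp
  simp only [h1] at h
  rw [h, prod_eq_single k]
  · simp
  · intro i _ hi
    simp [hi, hp]
  · simp

/-- A Chernoff bound for sums of independent bounded variables. -/
lemma smeas_deviation_le [Fintype J] {p : Fin n → J → ℝ} (hp0 : ∀ i j, 0 ≤ p i j)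
    (hp : ∀ i, ∑ j, p i j = 1) (g : Fin n → J → ℝ) (hg : ∀ i j, |g i j| ≤ 1)
    {lam : ℝ} (hl0 : 0 ≤ lam) (hl1 : lam ≤ 1) :
    smeas (prodMeas p) {a | lam * n ≤ ∑ i, g i (a i) - ∑ i, ∑ j, p i j * g i j}
      ≤ Real.exp (-(lam ^ 2 / 16 * n)) := by
  set m : Fin n → ℝ := fun i => ∑ j, p i j * g i j with hm
  have hmabs : ∀ i, |m i| ≤ 1 := by
    intro i
    calc |m i| ≤ ∑ j, |p i j * g i j| := abs_sum_le_sum_abs _ _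
      _ ≤ ∑ j, p i j := sum_le_sum fun j _ => by
          rw [abs_mul, abs_of_nonneg (hp0 i j)]
          nlinarith [hp0 i j, hg i j]
      _ = 1 := hp i
  set s : ℝ := lam / 8 with hs
  have hs0 : 0 ≤ s := by positivity
  have key := smeas_ge_le_exp (prodMeas_nonneg hp0)
    (fun a : Fin n → J => ∑ i, g i (a i) - ∑ i, m i) (lam * n) hs0
  refine key.trans ?_
  have h1 : ∀ a : Fin n → J, s * (∑ i, g i (a i) - ∑ i, m i)
      = ∑ i, s * (g i (a i) - m i) := by
    intro a
    rw [← sum_sub_distrib, mul_sum]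
  simp only [h1]
  rw [sum_prodMeas_mul_exp p (fun i j => s * (g i j - m i))]
  have h2 : ∀ i, ∑ j, p i j * Real.exp (s * (g i j - m i)) ≤ Real.exp (4 * s ^ 2) := by
    intro i
    have h3 : ∀ j, p i j * Real.exp (s * (g i j - m i))
        ≤ p i j * (1 + 4 * s ^ 2) + s * (p i j * g i j) - s * m i * p i j := by
      intro j
      have ha := abs_le.1 (hg i j)
      have hb := abs_le.1 (hmabs i)
      have hx : |s * (g i j - m i)| ≤ 1 := by
        rw [abs_mul, abs_of_nonneg hs0]
        have : |g i j - m i| ≤ 2 := abs_le.2 ⟨by linarith, by linarith⟩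
        nlinarith
      have he := (abs_le.1 (Real.abs_exp_sub_one_sub_id_le hx)).2
      have hsq : (s * (g i j - m i)) ^ 2 ≤ 4 * s ^ 2 := by
        have : (g i j - m i) ^ 2 ≤ 4 := by nlinarith
        nlinarith [sq_nonneg s]
      have : Real.exp (s * (g i j - m i)) ≤ 1 + s * (g i j - m i) + 4 * s ^ 2 := by linarith
      nlinarith [mul_le_mul_of_nonneg_left this (hp0 i j)]
    refine (sum_le_sum fun j _ => h3 j).trans ?_
    rw [sum_sub_distrib, sum_add_distrib, ← sum_mul, ← mul_sum, ← mul_sum, hp i]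
    have := Real.add_one_le_exp (4 * s ^ 2)
    simp only [hm]
    linarith
  have h4 : ∏ i, ∑ j, p i j * Real.exp (s * (g i j - m i)) ≤ Real.exp (4 * s ^ 2 * n) := by
    refine (prod_le_prod (fun i _ => sum_nonneg fun j _ =>
      mul_nonneg (hp0 i j) (Real.exp_nonneg _)) fun i _ => h2 i).trans (le_of_eq ?_)
    rw [prod_const, card_univ, Fintype.card_fin, ← Real.exp_nat_mul]
    ring_nf
  refine (mul_le_mul_of_nonneg_left h4 (Real.exp_nonneg _)).trans (le_of_eq ?_)
  rw [← Real.exp_add]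
  congr 1
  simp only [hs]
  ring

lemma sum_piecewise_smeas [Fintype J] {p : Fin n → J → ℝ} (hp : ∀ i, ∑ j, p i j = 1)
    (K : Finset (Fin n)) (A : Set (Fin n → J)) :
    ∑ c, prodMeas p c * smeas (prodMeas p) {a | K.piecewise c a ∈ A}
      = smeas (prodMeas p) A := by
  classical
  let e : (Fin n → J) × (Fin n → J) → (Fin n → J) × (Fin n → J) :=
    fun x => (K.piecewise x.1 x.2, K.piecewise x.2 x.1)
  have he : Function.Involutive e := by
    rintro ⟨c, a⟩
    simp only [e, Prod.mk.injEq]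
    constructor <;> ext i <;> by_cases hi : i ∈ K <;> simp [hi]
  have hprod : ∀ x, prodMeas p (e x).1 * prodMeas p (e x).2
      = prodMeas p x.1 * prodMeas p x.2 := by
    rintro ⟨c, a⟩
    simp only [e, prodMeas, ← prod_mul_distrib]
    refine prod_congr rfl fun i _ => ?_
    by_cases hi : i ∈ K
    · simp [hi]
    · simp [hi, mul_comm]
  have h1 : ∑ c, prodMeas p c * smeas (prodMeas p) {a | K.piecewise c a ∈ A}
      = ∑ x : (Fin n → J) × (Fin n → J),
        prodMeas p (e x).1 * prodMeas p (e x).2 * (if (e x).1 ∈ A then 1 else 0) := by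
    rw [Fintype.sum_prod_type]
    refine sum_congr rfl fun c _ => ?_
    rw [smeas, mul_sum]
    refine sum_congr rfl fun a _ => ?_
    rw [hprod]
    by_cases h : K.piecewise c a ∈ A
    · rw [Set.indicator_of_mem (by exact h), if_pos h]
      simp
    · rw [Set.indicator_of_notMem (by exact h), if_neg h]
      simp
  have h2 := (he.toPerm e).sum_comp univ
    (fun x => prodMeas p x.1 * prodMeas p x.2 * (if x.1 ∈ A then (1 : ℝ) else 0)) (by simp)
  rw [h1]
  refine h2.trans ?_
  rw [Fintype.sum_prod_type, smeas]
  refine sum_congr rfl fun c _ => ?_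
  have : ∀ a, prodMeas p c * prodMeas p a * (if c ∈ A then (1 : ℝ) else 0)
      = A.indicator (prodMeas p) c * prodMeas p a := by
    intro a
    by_cases h : c ∈ A <;> simp [h]
  simp only [this]
  rw [← mul_sum, sum_prodMeas hp, mul_one]

lemma smeas_cylinder_ge [Fintype J] [DecidableEq J] {p : Fin n → J → ℝ} {κ : ℝ} (hκ : 0 ≤ κ)
    (hp : ∀ i, ∑ j, p i j = 1) (hκp : ∀ i j, κ ≤ p i j)
    (K : Finset (Fin n)) (σ : Fin n → J) :
    κ ^ K.card ≤ smeas (prodMeas p) {c | ∀ i ∈ K, c i = σ i} := by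
  classical
  have h1 : smeas (prodMeas p) {c | ∀ i ∈ K, c i = σ i}
      = ∏ i, ∑ j, p i j * (if i ∈ K → j = σ i then 1 else 0) := by
    rw [← sum_prod_apply, smeas]
    refine sum_congr rfl fun c _ => ?_
    rw [prod_mul_distrib]
    by_cases h : ∀ i ∈ K, c i = σ i
    · have h2 : ∏ i, (if i ∈ K → c i = σ i then (1 : ℝ) else 0) = 1 :=
        prod_eq_one fun i _ => if_pos (h i)
      rw [Set.indicator_of_mem (by exact h), h2, mul_one, prodMeas]
    · have h2 : ∏ i, (if i ∈ K → c i = σ i then (1 : ℝ) else 0) = 0 := by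
        push Not at h
        obtain ⟨i, hi, hne⟩ := h
        exact prod_eq_zero (mem_univ i) (if_neg fun h => hne (h hi))
      rw [Set.indicator_of_notMem (by exact h), h2, mul_zero]
  rw [h1, ← prod_const, ← Finset.prod_subset (subset_univ K)]
  · refine prod_le_prod (fun i _ => hκ) fun i hi => ?_
    simpa [hi] using hκp i (σ i)
  · intro i _ hi
    simp [hi, hp]

end ProductMeasure

/-! ### Hamming neighbourhoods in product spaces -/

section Hamming

lemma pow_hammingDist {n : ℕ} {J : Type*} [DecidableEq J] (x : ℝ) (r g : Fin n → J) :
    x ^ hammingDist r g = ∏ i, if r i = g i then 1 else x := by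
  rw [hammingDist, prod_ite]
  simp

/-- If `q'` is close to `q`, and a set `B` lies in a Hamming neighbourhood of `G`, then the
`q`-measure of `G` is not much smaller than the `q'`-measure of `B`. -/
lemma smeas_neighbourhood_le {n : ℕ} {J : Type*} [Fintype J] [DecidableEq J]
    {q q' : Fin n → J → ℝ} {κ τ x : ℝ} (hκ : 0 < κ) (hx : 0 < x) (hx1 : x ≤ 1)
    (hq : ∀ i j, κ ≤ q i j) (hq0 : ∀ i j, 0 ≤ q' i j) (hq1 : ∀ i, ∑ j, q' i j = 1)
    (hqq : ∀ i j, q' i j ≤ q i j + τ) (hτ : 0 ≤ τ)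
    (G B : Set (Fin n → J)) (h : ℕ) (hB : ∀ r ∈ B, ∃ g ∈ G, hammingDist r g ≤ h) :
    smeas (prodMeas q') B * x ^ h ≤ (1 + (τ + x) / κ) ^ n * smeas (prodMeas q) G := by
  classical
  have hq'0 := prodMeas_nonneg hq0
  have h1 : ∀ r, B.indicator (prodMeas q') r * x ^ h
      ≤ ∑ g, G.indicator (fun _ => prodMeas q' r * x ^ hammingDist r g) g := by
    intro r
    have hnn : ∀ g, 0 ≤ G.indicator (fun _ => prodMeas q' r * x ^ hammingDist r g) g :=
      fun g => Set.indicator_nonneg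
        (fun _ _ => mul_nonneg (hq'0 r) (pow_nonneg hx.le _)) g
    by_cases hr : r ∈ B
    · obtain ⟨g, hg, hd⟩ := hB r hr
      rw [Set.indicator_of_mem hr]
      calc prodMeas q' r * x ^ h ≤ prodMeas q' r * x ^ hammingDist r g :=
            mul_le_mul_of_nonneg_left (pow_le_pow_of_le_one hx.le hx1 hd) (hq'0 r)
        _ = G.indicator (fun _ => prodMeas q' r * x ^ hammingDist r g) g := by
            rw [Set.indicator_of_mem hg]
        _ ≤ _ := single_le_sum
            (f := fun g => G.indicator (fun _ => prodMeas q' r * x ^ hammingDist r g) g)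
            (fun g _ => hnn g) (mem_univ g)
    · rw [Set.indicator_of_notMem hr, zero_mul]
      exact sum_nonneg fun g _ => hnn g
  have h2 : ∀ g, ∑ r, prodMeas q' r * x ^ hammingDist r g
      ≤ (1 + (τ + x) / κ) ^ n * prodMeas q g := by
    intro g
    have h3 : ∀ r, prodMeas q' r * x ^ hammingDist r g
        = ∏ i, (q' i (r i) * if r i = g i then 1 else x) := by
      intro r
      rw [pow_hammingDist, prodMeas, prod_mul_distrib]
    simp only [h3]
    rw [sum_prod_apply (fun i j => q' i j * if j = g i then 1 else x)]
    have h4 : (1 + (τ + x) / κ) ^ n * prodMeas q g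
        = ∏ i, ((1 + (τ + x) / κ) * q i (g i)) := by
      rw [prod_mul_distrib, prod_const, card_univ, Fintype.card_fin, prodMeas]
    rw [h4]
    refine prod_le_prod (fun i _ => sum_nonneg fun j _ => mul_nonneg (hq0 i j) ?_) fun i _ => ?_
    · split_ifs <;> linarith
    · calc ∑ j, q' i j * (if j = g i then 1 else x)
          ≤ ∑ j, ((if j = g i then q' i j else 0) + x * q' i j) := by
            refine sum_le_sum fun j _ => ?_
            have := hq0 i j
            split_ifs
            · nlinarith
            · linarith
        _ = q' i (g i) + x := by
            rw [sum_add_distrib, ← mul_sum, hq1]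
            simp
        _ ≤ q i (g i) + (τ + x) := by linarith [hqq i (g i)]
        _ ≤ q i (g i) + (τ + x) / κ * q i (g i) := by
            have : τ + x = (τ + x) / κ * κ := by field_simp
            have h5 : (τ + x) / κ * κ ≤ (τ + x) / κ * q i (g i) :=
              mul_le_mul_of_nonneg_left (hq i (g i)) (by positivity)
            linarith
        _ = _ := by ring
  calc smeas (prodMeas q') B * x ^ h
      = ∑ r, B.indicator (prodMeas q') r * x ^ h := by rw [smeas, sum_mul]
    _ ≤ ∑ r, ∑ g, G.indicator (fun _ => prodMeas q' r * x ^ hammingDist r g) g :=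
        sum_le_sum fun r _ => h1 r
    _ = ∑ g, ∑ r, G.indicator (fun _ => prodMeas q' r * x ^ hammingDist r g) g := sum_comm
    _ ≤ ∑ g, (1 + (τ + x) / κ) ^ n * G.indicator (prodMeas q) g := by
        refine sum_le_sum fun g _ => ?_
        by_cases hg : g ∈ G
        · simpa [Set.indicator_of_mem hg] using h2 g
        · simp [Set.indicator_of_notMem hg]
    _ = _ := by rw [smeas, mul_sum]

lemma sum_bool_cons {n : ℕ} (f : (Fin (n + 1) → Bool) → ℝ) :
    ∑ a, f a = ∑ j : Bool, ∑ a : Fin n → Bool, f (Fin.cons j a) := by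
  rw [← (Fin.consEquiv (fun _ => Bool)).sum_comp, Fintype.sum_prod_type]
  rfl

lemma prodMeas_cons {n : ℕ} (p : Fin (n + 1) → Bool → ℝ) (j : Bool) (a : Fin n → Bool) :
    prodMeas p (Fin.cons j a) = p 0 j * prodMeas (fun i => p i.succ) a := by
  simp [prodMeas, Fin.prod_univ_succ]

lemma smeas_cons {n : ℕ} (p : Fin (n + 1) → Bool → ℝ) (A : Set (Fin (n + 1) → Bool)) :
    smeas (prodMeas p) A = ∑ j, p 0 j *
      smeas (prodMeas fun i => p i.succ) {a | (Fin.cons j a : Fin (n + 1) → Bool) ∈ A} := by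
  rw [smeas, sum_bool_cons]
  refine sum_congr rfl fun j _ => ?_
  rw [smeas, mul_sum]
  refine sum_congr rfl fun a _ => ?_
  by_cases h : (Fin.cons j a : Fin (n + 1) → Bool) ∈ A
  · rw [Set.indicator_of_mem h, Set.indicator_of_mem (by exact h), prodMeas_cons]
  · rw [Set.indicator_of_notMem h, Set.indicator_of_notMem (by exact h), mul_zero]

lemma hammingDist_cons {n : ℕ} (j j' : Bool) (a a' : Fin n → Bool) :
    hammingDist (Fin.cons j a : Fin (n + 1) → Bool) (Fin.cons j' a')
      = (if j = j' then 0 else 1) + hammingDist a a' := by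
  simp only [hammingDist, card_filter, Fin.sum_univ_succ, Fin.cons_zero, Fin.cons_succ]
  congr 1
  by_cases h : j = j' <;> simp [h]

lemma cosh_factor_le {u : ℝ} (hu : 0 < u) (m : ℝ) :
    (1 + u * (1 - m)) * m ≤ (1 + u) ^ 2 / (4 * u) := by
  rw [le_div_iff₀ (by positivity)]
  nlinarith [sq_nonneg (2 * u * m - (1 + u))]

/-- Exponential moment bound for the Hamming distance to a set, expressed through an upper bound
`f` for the distance. -/
lemma exists_distance_bound {s : ℝ} (hs : 0 ≤ s) : ∀ (n : ℕ) (p : Fin n → Bool → ℝ),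
    (∀ i j, 0 < p i j) → (∀ i, ∑ j, p i j = 1) → ∀ A : Set (Fin n → Bool),
    0 < smeas (prodMeas p) A → ∃ f : (Fin n → Bool) → ℕ,
      (∀ a, ∃ a' ∈ A, hammingDist a a' ≤ f a) ∧
      (∑ a, prodMeas p a * Real.exp (s * f a)) * smeas (prodMeas p) A
        ≤ ((1 + Real.exp s) ^ 2 / (4 * Real.exp s)) ^ n := by
  intro n
  induction n with
  | zero =>
    intro p _ _ A hA
    have hne : A.Nonempty := by
      by_contra h
      rw [Set.not_nonempty_iff_eq_empty] at h
      simp [h, smeas] at hA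
    obtain ⟨a₀, ha₀⟩ := hne
    refine ⟨fun _ => 0, fun a => ⟨a₀, ha₀, ?_⟩, ?_⟩
    · simp [hammingDist]
    · have hAu : A = Set.univ := Set.eq_univ_of_forall fun a => by
        rwa [Subsingleton.elim a a₀]
      simp [hAu, smeas, prodMeas]
  | succ n ih =>
    intro p hp0 hp A hA
    set u := Real.exp s with hu
    have hu1 : 1 ≤ u := Real.one_le_exp hs
    set c := (1 + u) ^ 2 / (4 * u) with hc
    have hc0 : 0 ≤ c := by positivity
    set p' : Fin n → Bool → ℝ := fun i => p i.succ with hp'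
    set S : Bool → Set (Fin n → Bool) :=
      fun j => {a | (Fin.cons j a : Fin (n + 1) → Bool) ∈ A} with hS
    set m : Bool → ℝ := fun j => smeas (prodMeas p') (S j)
    have hm0 : ∀ j, 0 ≤ m j :=
      fun j => smeas_nonneg (prodMeas_nonneg fun i j => (hp0 _ j).le) _
    have hAm : smeas (prodMeas p) A = ∑ j, p 0 j * m j := smeas_cons p A
    obtain ⟨j₁, hj₁⟩ : ∃ j₁, ∀ j, m j ≤ m j₁ := by
      obtain ⟨j₁, -, h⟩ := exists_max_image (univ : Finset Bool) m ⟨true, mem_univ _⟩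
      exact ⟨j₁, fun j => h j (mem_univ j)⟩
    have hM : 0 < m j₁ := by
      by_contra h
      have : ∀ j, m j = 0 := fun j => le_antisymm ((hj₁ j).trans (not_lt.1 h)) (hm0 j)
      simp [hAm, this] at hA
    have ihp := ih p' (fun i j => hp0 _ j) (fun i => hp _)
    have hbranch : ∀ j, ∃ f : (Fin n → Bool) → ℕ,
        (∀ a, ∃ a' ∈ A, hammingDist (Fin.cons j a : Fin (n + 1) → Bool) a' ≤ f a) ∧
        (∑ a, prodMeas p' a * Real.exp (s * f a)) * m j₁
          ≤ c ^ n * (1 + u * (1 - m j / m j₁)) := by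
      intro j
      by_cases hj : m j₁ ≤ m j * u
      · have hmj : 0 < m j := by
          by_contra h
          nlinarith [not_lt.1 h]
        obtain ⟨f, hf, hfs⟩ := ihp (S j) hmj
        refine ⟨f, fun a => ?_, ?_⟩
        · obtain ⟨a', ha', hd⟩ := hf a
          exact ⟨Fin.cons j a', ha', by simpa [hammingDist_cons] using hd⟩
        · set E := ∑ a, prodMeas p' a * Real.exp (s * f a)
          have hfs' : E * m j ≤ c ^ n := hfs
          have hy0 : 0 < m j / m j₁ := by positivity
          set y := m j / m j₁ with hy
          have hmy : m j = y * m j₁ := by rw [hy]; field_simp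
          have hy1 : y ≤ 1 := (div_le_one hM).2 (hj₁ j)
          have hyu : 1 ≤ y * u := by
            rw [hmy] at hj
            nlinarith
          have h1 : E * m j₁ * y ≤ c ^ n := by rw [hmy] at hfs'; linarith
          have h2 : 1 ≤ y * (1 + u * (1 - y)) := by nlinarith
          have h3 : (E * m j₁) * y ≤ (c ^ n * (1 + u * (1 - y))) * y := by
            have := mul_le_mul_of_nonneg_left h2 (pow_nonneg hc0 n)
            linarith
          exact le_of_mul_le_mul_right h3 hy0
      · obtain ⟨f, hf, hfs⟩ := ihp (S j₁) hM
        refine ⟨fun a => 1 + f a, fun a => ?_, ?_⟩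
        · obtain ⟨a', ha', hd⟩ := hf a
          refine ⟨Fin.cons j₁ a', ha', ?_⟩
          change _ ≤ 1 + f a
          rw [hammingDist_cons]
          split_ifs <;> omega
        · have h1 : ∀ a, prodMeas p' a * Real.exp (s * (1 + f a : ℕ))
              = u * (prodMeas p' a * Real.exp (s * f a)) := by
            intro a
            rw [Nat.cast_add, Nat.cast_one, mul_add, mul_one, Real.exp_add]
            ring
          simp only [h1]
          rw [← mul_sum, mul_assoc]
          have h2 : m j / m j₁ * u ≤ 1 := by
            rw [div_mul_eq_mul_div, div_le_one hM]
            exact (not_le.1 hj).le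
          have h3 : u ≤ 1 + u * (1 - m j / m j₁) := by linarith
          calc u * ((∑ a, prodMeas p' a * Real.exp (s * f a)) * m j₁) ≤ u * c ^ n :=
                mul_le_mul_of_nonneg_left hfs (by positivity)
            _ ≤ _ := by
                rw [mul_comm]
                exact mul_le_mul_of_nonneg_left h3 (pow_nonneg hc0 n)
    choose f hf hfs using hbranch
    refine ⟨fun a => f (a 0) (fun i => a i.succ), fun a => ?_, ?_⟩
    · obtain ⟨a', ha', hd⟩ := hf (a 0) (fun i => a i.succ)
      refine ⟨a', ha', ?_⟩
      have : (Fin.cons (a 0) (fun i => a i.succ) : Fin (n + 1) → Bool) = a :=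
        Fin.cons_self_tail a
      rwa [this] at hd
    · rw [sum_bool_cons]
      simp only [prodMeas_cons, Fin.cons_zero, Fin.cons_succ]
      set E : Bool → ℝ := fun j => ∑ a, prodMeas p' a * Real.exp (s * f j a) with hE
      have h1 : ∑ j, ∑ a, p 0 j * prodMeas p' a * Real.exp (s * f j a) = ∑ j, p 0 j * E j := by
        refine sum_congr rfl fun j _ => ?_
        rw [hE, mul_sum]
        exact sum_congr rfl fun a _ => mul_assoc _ _ _
      have h1' : ∑ j, ∑ a : Fin n → Bool,
          p 0 j * prodMeas (fun i => p i.succ) a * Real.exp (s * f j (fun i => a i))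
          = ∑ j, p 0 j * E j := h1
      rw [h1']
      set y : ℝ := ∑ j, p 0 j * (m j / m j₁) with hy
      have hAy : smeas (prodMeas p) A = y * m j₁ := by
        rw [hAm, hy, sum_mul]
        refine sum_congr rfl fun j _ => ?_
        field_simp
      have hy0 : 0 ≤ y := sum_nonneg fun j _ =>
        mul_nonneg (hp0 _ _).le (div_nonneg (hm0 j) hM.le)
      have h2 : (∑ j, p 0 j * E j) * m j₁ ≤ c ^ n * (1 + u * (1 - y)) := by
        have h3 : c ^ n * (1 + u * (1 - y))
            = ∑ j, p 0 j * (c ^ n * (1 + u * (1 - m j / m j₁))) := by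
          have := hp 0
          simp only [Fintype.sum_bool] at this hy ⊢
          rw [hy]
          linear_combination (-(c ^ n * (1 + u))) * this
        rw [h3, sum_mul]
        refine sum_le_sum fun j _ => ?_
        rw [mul_assoc]
        exact mul_le_mul_of_nonneg_left (hfs j) (hp0 _ _).le
      calc (∑ j, p 0 j * E j) * smeas (prodMeas p) A
          = (∑ j, p 0 j * E j) * m j₁ * y := by rw [hAy]; ring
        _ ≤ c ^ n * (1 + u * (1 - y)) * y := mul_le_mul_of_nonneg_right h2 hy0
        _ = c ^ n * ((1 + u * (1 - y)) * y) := by ring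
        _ ≤ c ^ n * c := mul_le_mul_of_nonneg_left
            (cosh_factor_le (by positivity) y) (pow_nonneg hc0 n)
        _ = c ^ (n + 1) := by rw [pow_succ]

/-- The set of points at Hamming distance at least `h` from a set is small. -/
lemma smeas_far_mul_le {n : ℕ} {p : Fin n → Bool → ℝ}
    (hp0 : ∀ i j, 0 < p i j) (hp : ∀ i, ∑ j, p i j = 1) (A : Set (Fin n → Bool))
    {s h : ℝ} (hs : 0 ≤ s) :
    smeas (prodMeas p) {a | ¬ ∃ a' ∈ A, (hammingDist a a' : ℝ) ≤ h} * smeas (prodMeas p) A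
      ≤ Real.exp (-(s * h) + s ^ 2 / 4 * n) := by
  have hμ : ∀ a, 0 ≤ prodMeas p a := prodMeas_nonneg fun i j => (hp0 i j).le
  rcases (smeas_nonneg hμ A).eq_or_lt with hA | hA
  · rw [← hA, mul_zero]
    exact Real.exp_nonneg _
  obtain ⟨f, hf, hfs⟩ := exists_distance_bound hs n p hp0 hp A hA
  have h1 : smeas (prodMeas p) {a | ¬ ∃ a' ∈ A, (hammingDist a a' : ℝ) ≤ h}
      ≤ smeas (prodMeas p) {a | h ≤ (f a : ℝ)} := by
    refine smeas_mono hμ fun a ha => ?_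
    obtain ⟨a', ha', hd⟩ := hf a
    by_contra hcon
    refine ha ⟨a', ha', ?_⟩
    have : (hammingDist a a' : ℝ) ≤ f a := by exact_mod_cast hd
    have h2 : ¬ h ≤ (f a : ℝ) := hcon
    linarith
  have h2 := h1.trans (smeas_ge_le_exp hμ (fun a => (f a : ℝ)) h hs)
  have h3 : (1 + Real.exp s) ^ 2 / (4 * Real.exp s) ≤ Real.exp (s ^ 2 / 4) := by
    have h4 : (1 + Real.exp s) ^ 2 / (4 * Real.exp s) = Real.cosh (s / 2) ^ 2 := by
      rw [Real.cosh_eq]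
      have e1 : Real.exp s = Real.exp (s / 2) ^ 2 := by
        rw [← Real.exp_nat_mul]; congr 1; push_cast; ring
      have e2 : Real.exp (-(s / 2)) = (Real.exp (s / 2))⁻¹ := Real.exp_neg _
      have := Real.exp_pos (s / 2)
      rw [e1, e2]
      field_simp
      ring
    rw [h4]
    calc Real.cosh (s / 2) ^ 2 ≤ Real.exp ((s / 2) ^ 2 / 2) ^ 2 :=
          pow_le_pow_left₀ (Real.cosh_pos _).le (Real.cosh_le_exp_half_sq _) 2
      _ = Real.exp (s ^ 2 / 4) := by
          rw [← Real.exp_nat_mul]; congr 1; push_cast; ring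
  have h5 : ((1 + Real.exp s) ^ 2 / (4 * Real.exp s)) ^ n ≤ Real.exp (s ^ 2 / 4 * n) := by
    refine (pow_le_pow_left₀ (by positivity) h3 n).trans (le_of_eq ?_)
    rw [← Real.exp_nat_mul, mul_comm]
  calc _ ≤ Real.exp (-(s * h)) * (∑ a, prodMeas p a * Real.exp (s * f a)) *
        smeas (prodMeas p) A := mul_le_mul_of_nonneg_right h2 hA.le
    _ ≤ Real.exp (-(s * h)) * Real.exp (s ^ 2 / 4 * n) := by
        rw [mul_assoc]
        exact mul_le_mul_of_nonneg_left (hfs.trans h5) (Real.exp_nonneg _)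
    _ = _ := by rw [← Real.exp_add]

lemma smeas_map {n : ℕ} {I J : Type*} [Fintype I] [Fintype J] (q : Fin n → I → ℝ)
    (p : Fin n → J → ℝ) (φ : I → J) [DecidableEq J]
    (h : ∀ i j, ∑ x with φ x = j, q i x = p i j) (A : Set (Fin n → J)) :
    smeas (prodMeas q) {r | (fun i => φ (r i)) ∈ A} = smeas (prodMeas p) A := by
  classical
  rw [smeas, smeas, ← sum_fiberwise univ (fun r : Fin n → I => fun i => φ (r i))]
  refine sum_congr rfl fun a _ => ?_
  have h1 : ∑ r : Fin n → I with (fun i => φ (r i)) = a, prodMeas q r = prodMeas p a := by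
    simp only [prodMeas, ← h]
    rw [Finset.prod_univ_sum]
    refine sum_congr ?_ fun _ _ => rfl
    ext r
    simp [funext_iff]
  by_cases ha : a ∈ A
  · rw [Set.indicator_of_mem ha, ← h1]
    refine sum_congr rfl fun r hr => ?_
    rw [Set.indicator_of_mem]
    simpa [(mem_filter.1 hr).2] using ha
  · rw [Set.indicator_of_notMem ha]
    refine sum_eq_zero fun r hr => ?_
    rw [Set.indicator_of_notMem]
    simpa [(mem_filter.1 hr).2] using ha

end Hamming

/-! ### Growing a structured set of intersection patterns -/

section Growth

variable {n D : ℕ}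

/-- The part of the intersection vector of `a` and `b` coming from the coordinates in `K`. -/
def capSum (v : Fin n → Fin D → ℤ) (K : Finset (Fin n)) (a b : Fin n → Bool) (d : Fin D) : ℤ :=
  ∑ i ∈ K, if a i ∧ b i then v i d else 0

/-- Every pair in `A × B` can be changed on the coordinates in `P` into pairs of members of `A₀`
for which the contribution of `P` to the intersection vector realises `x₀` plus an arbitrary
subset sum of `l`, with `x₀` of size at most `|P|`. -/
def Extends (R : Fin D → ℤ) (v : Fin n → Fin D → ℤ) (A₀ : Set (Fin n → Bool))
    (l : List (Fin D → ℤ)) (P : Finset (Fin n)) (A B : Set (Fin n → Bool)) : Prop :=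
  ∃ x₀ : Fin D → ℤ, (∀ d, |x₀ d| ≤ P.card * R d) ∧
    ∀ a ∈ A, ∀ b ∈ B, ∀ l' : List (Fin D → ℤ), l'.Sublist l → ∃ a' ∈ A₀, ∃ b' ∈ A₀,
      (∀ i, i ∉ P → a' i = a i) ∧ (∀ i, i ∉ P → b' i = b i) ∧
      ∀ d, capSum v P a' b' d = x₀ d + l'.sum d

lemma capSum_union (v : Fin n → Fin D → ℤ) {P K : Finset (Fin n)} (h : Disjoint P K)
    (a b : Fin n → Bool) (d : Fin D) :
    capSum v (P ∪ K) a b d = capSum v P a b d + capSum v K a b d :=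
  sum_union h

lemma capSum_congr (v : Fin n → Fin D → ℤ) {K : Finset (Fin n)} {a b a' b' : Fin n → Bool}
    (ha : ∀ i ∈ K, a i = a' i) (hb : ∀ i ∈ K, b i = b' i) (d : Fin D) :
    capSum v K a b d = capSum v K a' b' d :=
  sum_congr rfl fun i hi => by rw [ha i hi, hb i hi]

lemma capSum_le {R : Fin D → ℤ} {v : Fin n → Fin D → ℤ} (hv : ∀ i d, |v i d| ≤ R d)
    (K : Finset (Fin n)) (a b : Fin n → Bool) (d : Fin D) :
    |capSum v K a b d| ≤ K.card * R d := by
  calc |capSum v K a b d| ≤ ∑ i ∈ K, |if a i ∧ b i then v i d else 0| := abs_sum_le_sum_abs _ _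
    _ ≤ ∑ i ∈ K, R d := sum_le_sum fun i _ => by
        have := hv i d
        split_ifs
        · exact this
        · rw [abs_zero]
          exact (abs_nonneg _).trans this
    _ = _ := by simp

lemma Extends.refl (R : Fin D → ℤ) (v : Fin n → Fin D → ℤ) (A₀ : Set (Fin n → Bool)) :
    Extends R v A₀ [] ∅ A₀ A₀ := by
  refine ⟨0, by simp, fun a ha b hb l' hl' => ⟨a, ha, b, hb, by simp, by simp, fun d => ?_⟩⟩
  simp [List.sublist_nil.1 hl', capSum]

lemma Extends.step {R : Fin D → ℤ} {v : Fin n → Fin D → ℤ} {A₀ : Set (Fin n → Bool)}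
    {l l₂ : List (Fin D → ℤ)} {P K : Finset (Fin n)} {A B A' B' : Set (Fin n → Bool)}
    (h : Extends R v A₀ l P A B) (hPK : Disjoint P K) (c : Fin D → ℤ)
    (hc : ∀ d, |c d| ≤ K.card * R d)
    (hstep : ∀ a ∈ A', ∀ b ∈ B', ∀ l' : List (Fin D → ℤ), l'.Sublist l₂ →
      ∃ σ τ : Fin n → Bool, ∃ l'' : List (Fin D → ℤ),
      l''.Sublist l ∧ K.piecewise σ a ∈ A ∧ K.piecewise τ b ∈ B ∧
      ∀ d, capSum v K σ τ d + l''.sum d = c d + l'.sum d) :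
    Extends R v A₀ l₂ (P ∪ K) A' B' := by
  obtain ⟨x₀, hx₀, hx⟩ := h
  refine ⟨x₀ + c, fun d => ?_, fun a ha b hb l' hl' => ?_⟩
  · rw [card_union_of_disjoint hPK]
    push_cast
    have := abs_add_le (x₀ d) (c d)
    have h1 := hx₀ d
    have h2 := hc d
    simp only [Pi.add_apply]
    linarith
  · obtain ⟨σ, τ, l'', hl'', hσ, hτ, hsum⟩ := hstep a ha b hb l' hl'
    obtain ⟨a', ha', b', hb', haP, hbP, hsum'⟩ := hx _ hσ _ hτ l'' hl''
    refine ⟨a', ha', b', hb', fun i hi => ?_, fun i hi => ?_, fun d => ?_⟩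
    · rw [mem_union, not_or] at hi
      rw [haP i hi.1, piecewise_eq_of_notMem _ _ _ hi.2]
    · rw [mem_union, not_or] at hi
      rw [hbP i hi.1, piecewise_eq_of_notMem _ _ _ hi.2]
    · have hK : ∀ i ∈ K, i ∉ P := fun i hi hiP => (disjoint_left.1 hPK hiP hi)
      rw [capSum_union v hPK, hsum' d,
        capSum_congr v (a := a') (b := b') (a' := σ) (b' := τ)
          (fun i hi => by rw [haP i (hK i hi), piecewise_eq_of_mem _ _ _ hi])
          (fun i hi => by rw [hbP i (hK i hi), piecewise_eq_of_mem _ _ _ hi])]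
      have := hsum d
      simp only [Pi.add_apply]
      linarith

/-- The section of a family at a fixed pattern on the coordinates in `K`. -/
def sectionAt (K : Finset (Fin n)) (σ : Fin n → Bool) (A : Set (Fin n → Bool)) :
    Set (Fin n → Bool) :=
  {a | K.piecewise σ a ∈ A}

lemma Extends.section_section {R : Fin D → ℤ} {v : Fin n → Fin D → ℤ}
    (hv : ∀ i d, |v i d| ≤ R d) {A₀ : Set (Fin n → Bool)}
    {l : List (Fin D → ℤ)} {P K : Finset (Fin n)} {A B : Set (Fin n → Bool)}
    (h : Extends R v A₀ l P A B) (hPK : Disjoint P K) (σ τ : Fin n → Bool) :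
    Extends R v A₀ l (P ∪ K) (sectionAt K σ A) (sectionAt K τ B) :=
  h.step hPK (capSum v K σ τ) (capSum_le hv K σ τ)
    fun _ ha _ hb l' hl' => ⟨σ, τ, l', hl', ha, hb, fun _ => rfl⟩

lemma Extends.union_section {R : Fin D → ℤ} {v : Fin n → Fin D → ℤ}
    (hR : ∀ d, 0 ≤ R d) {A₀ : Set (Fin n → Bool)}
    {l : List (Fin D → ℤ)} {P K : Finset (Fin n)} {A B : Set (Fin n → Bool)}
    (h : Extends R v A₀ l P A B) (hPK : Disjoint P K) (σ σ' : Fin n → Bool) :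
    Extends R v A₀ l (P ∪ K) (sectionAt K σ A ∪ sectionAt K σ' A)
      (sectionAt K (fun _ => false) B) := by
  refine h.step hPK 0 (fun d => ?_) fun a ha b hb l' hl' => ?_
  · have := hR d
    simp only [Pi.zero_apply, abs_zero]
    positivity
  · rcases ha with ha | ha
    · exact ⟨σ, fun _ => false, l', hl', ha, hb, fun d => by simp [capSum]⟩
    · exact ⟨σ', fun _ => false, l', hl', ha, hb, fun d => by simp [capSum]⟩

lemma Extends.inter_section {R : Fin D → ℤ} {v : Fin n → Fin D → ℤ}
    (hv : ∀ i d, |v i d| ≤ R d) {A₀ : Set (Fin n → Bool)}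
    {l : List (Fin D → ℤ)} {P S S' : Finset (Fin n)} {A B : Set (Fin n → Bool)}
    (h : Extends R v A₀ l P A B) (hPK : Disjoint P (S ∪ S')) {u : Fin D → ℤ}
    (hu : ∀ d, u d = ∑ i ∈ S, v i d - ∑ i ∈ S', v i d) :
    Extends R v A₀ (u :: l) (P ∪ (S ∪ S'))
      (sectionAt (S ∪ S') (fun i => decide (i ∈ S)) A ∩
        sectionAt (S ∪ S') (fun i => decide (i ∈ S')) A)
      (sectionAt (S ∪ S') (fun _ => true) B) := by
  have hcap : ∀ T : Finset (Fin n), T ⊆ S ∪ S' → ∀ d,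
      capSum v (S ∪ S') (fun i => decide (i ∈ T)) (fun _ => true) d = ∑ i ∈ T, v i d := by
    intro T hT d
    simp only [capSum, decide_eq_true_eq, and_true]
    rw [← sum_filter]
    congr 1
    ext i
    simp only [mem_filter]
    exact ⟨fun h => h.2, fun h => ⟨hT h, h⟩⟩
  refine h.step hPK (fun d => ∑ i ∈ S', v i d) (fun d => ?_) fun a ha b hb l' hl' => ?_
  · rw [← hcap S' subset_union_right]
    exact capSum_le hv _ _ _ d
  · rcases List.sublist_cons_iff.1 hl' with hl' | ⟨r, rfl, hr⟩
    · exact ⟨_, _, l', hl', ha.2, hb, fun d => by rw [hcap S' subset_union_right]⟩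
    · refine ⟨_, _, r, hr, ha.1, hb, fun d => ?_⟩
      rw [hcap S subset_union_left, List.sum_cons, Pi.add_apply, hu d]
      ring

lemma exists_section_ge {p : Fin n → Bool → ℝ} (hp0 : ∀ i j, 0 ≤ p i j)
    (hp : ∀ i, ∑ j, p i j = 1) (K : Finset (Fin n)) (A : Set (Fin n → Bool)) :
    ∃ σ, smeas (prodMeas p) A ≤ smeas (prodMeas p) (sectionAt K σ A) := by
  by_contra! hcon
  have h1 := sum_piecewise_smeas hp K A
  have h2 : ∑ c, prodMeas p c * smeas (prodMeas p) (sectionAt K c A)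
      < ∑ c, prodMeas p c * smeas (prodMeas p) A := by
    refine sum_lt_sum (fun c _ => mul_le_mul_of_nonneg_left (hcon c).le
      (prodMeas_nonneg hp0 c)) ?_
    by_contra! h
    have h3 : ∀ c, prodMeas p c = 0 := by
      intro c
      by_contra hne
      have hpos : 0 < prodMeas p c := lt_of_le_of_ne (prodMeas_nonneg hp0 c) (Ne.symm hne)
      have := h c (mem_univ c)
      nlinarith [hcon c]
    have := sum_prodMeas hp
    simp [h3] at this
  rw [← sum_mul, sum_prodMeas hp, one_mul] at h2
  exact absurd h1 (ne_of_lt h2)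

lemma section_ge_of_sections_le {p : Fin n → Bool → ℝ} {κ E : ℝ} (hκ : 0 < κ)
    (hκ1 : κ ≤ 1) (hE : 0 ≤ E) (hκp : ∀ i j, κ ≤ p i j)
    (hp : ∀ i, ∑ j, p i j = 1) {K : Finset (Fin n)} {k : ℕ} (hK : K.card ≤ k)
    (A : Set (Fin n → Bool))
    (hA : ∀ σ, smeas (prodMeas p) (sectionAt K σ A) ≤ (1 + E) * smeas (prodMeas p) A)
    (σ : Fin n → Bool) :
    (1 - E / κ ^ k) * smeas (prodMeas p) A ≤ smeas (prodMeas p) (sectionAt K σ A) := by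
  classical
  have hp0 : ∀ i j, 0 ≤ p i j := fun i j => hκ.le.trans (hκp i j)
  have hμ : ∀ a, 0 ≤ prodMeas p a := prodMeas_nonneg hp0
  set α := smeas (prodMeas p) A with hα
  set β := smeas (prodMeas p) (sectionAt K σ A) with hβ
  have hα0 : 0 ≤ α := smeas_nonneg hμ A
  set Z : Set (Fin n → Bool) := {c | ∀ i ∈ K, c i = σ i} with hZ
  set m := smeas (prodMeas p) Z with hm
  have hmk : κ ^ k ≤ m :=
    (pow_le_pow_of_le_one hκ.le hκ1 hK).trans (smeas_cylinder_ge hκ.le hp hκp K σ)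
  have hk0 : 0 < κ ^ k := pow_pos hκ k
  have hsec : ∀ c ∈ Z, sectionAt K c A = sectionAt K σ A := by
    intro c hc
    ext a
    have : K.piecewise c a = K.piecewise σ a := by
      ext i
      by_cases hi : i ∈ K
      · simp only [piecewise_eq_of_mem _ _ _ hi, hc i hi]
      · simp only [piecewise_eq_of_notMem _ _ _ hi]
    simp only [sectionAt, Set.mem_ofPred_eq, this]
  have h1 : α ≤ m * β + (1 - m) * ((1 + E) * α) := by
    have hc := smeas_compl_add (prodMeas p) Z
    rw [sum_prodMeas hp] at hc
    have h1m : 1 - m = smeas (prodMeas p) Zᶜ := by rw [← hc]; ring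
    rw [h1m, hm, smeas, smeas, sum_mul, sum_mul, ← sum_add_distrib, hα,
      ← sum_piecewise_smeas hp K A]
    refine sum_le_sum fun c _ => ?_
    by_cases hcZ : c ∈ Z
    · rw [Set.indicator_of_mem hcZ, Set.indicator_of_notMem (by simpa using hcZ), zero_mul,
        add_zero]
      have := hsec c hcZ
      simp only [sectionAt] at this
      rw [this]
      exact le_refl _
    · rw [Set.indicator_of_notMem hcZ, Set.indicator_of_mem (by simpa using hcZ), zero_mul,
        zero_add, sum_piecewise_smeas hp K A]
      exact mul_le_mul_of_nonneg_left (hA c) (hμ c)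
  have h2 : E * α ≤ m * (E * α / κ ^ k) := by
    have h3 : κ ^ k * (E * α / κ ^ k) = E * α := by field_simp
    have h4 : 0 ≤ E * α / κ ^ k := by positivity
    nlinarith
  have hm0 : 0 < m := hk0.trans_le hmk
  have h5 : 0 ≤ m * (β - (1 - E / κ ^ k) * α) := by
    have h6 : E / κ ^ k * α = E * α / κ ^ k := by ring
    have h7 : 0 ≤ m * (E * α) := by positivity
    nlinarith
  have := nonneg_of_mul_nonneg_right h5 hm0
  linarith

lemma inter_section_ge {κ E : ℝ} {α b α₁ α₂ αu αi b₁ β : ℝ} (hβ : β = E / κ) (hκ : 0 < κ)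
    (hκ1 : κ ≤ 1) (hE : 0 ≤ E) (hβ1 : β ≤ 1 / 8) (hα : 0 < α) (hb : 0 < b)
    (h1 : (1 - β) * α ≤ α₁) (h2 : (1 - β) * α ≤ α₂) (hui : αu + αi = α₁ + α₂) {b₀ : ℝ}
    (hb₀ : (1 - β) * b ≤ b₀) (hb₁ : (1 - β) * b ≤ b₁)
    (hu : αu * b₀ ≤ (1 + E) * (α * b)) (hu0 : 0 ≤ αu) :
    (1 - 7 * β) * (α * b) ≤ αi * b₁ := by
  have hEβ : E ≤ β := by
    rw [hβ, le_div_iff₀ hκ]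
    nlinarith
  have hβ0 : 0 ≤ β := hE.trans hEβ
  have h3 : αu * ((1 - β) * b) ≤ (1 + β) * (α * b) := by
    have := mul_le_mul_of_nonneg_left hb₀ hu0
    have h4 : (1 + E) * (α * b) ≤ (1 + β) * (α * b) :=
      mul_le_mul_of_nonneg_right (by linarith) (by positivity)
    linarith
  have h4 : αu * (1 - β) ≤ (1 + β) * α := by
    have : (αu * (1 - β)) * b ≤ ((1 + β) * α) * b := by linarith
    exact le_of_mul_le_mul_right this hb
  have h5 : αu ≤ (1 + 4 * β) * α := by
    have h6 : (1 + β) * α ≤ ((1 + 4 * β) * α) * (1 - β) := by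
      have : 0 ≤ α * (β * (2 - 4 * β)) := by
        have : 0 ≤ 2 - 4 * β := by linarith
        positivity
      nlinarith
    have h7 : αu * (1 - β) ≤ ((1 + 4 * β) * α) * (1 - β) := h4.trans h6
    exact le_of_mul_le_mul_right h7 (by linarith)
  have h6 : (1 - 6 * β) * α ≤ αi := by nlinarith
  calc (1 - 7 * β) * (α * b) ≤ ((1 - 6 * β) * α) * ((1 - β) * b) := by
        have : 0 ≤ β ^ 2 * (α * b) := by positivity
        nlinarith
    _ ≤ αi * b₁ := by
        have h8 : 0 ≤ 1 - 6 * β := by linarith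
        have h9 : 0 ≤ 1 - β := by linarith
        exact mul_le_mul h6 hb₁ (by positivity) ((by positivity : (0:ℝ) ≤ _).trans h6)

/-- Any list of vectors of norm at most one can be realised as the list of available increments,
at the cost of a small loss in measure. -/
lemma exists_extends {R : Fin D → ℤ} {v : Fin n → Fin D → ℤ} (hR : ∀ d, 0 ≤ R d)
    (hv : ∀ i d, |v i d| ≤ R d) {p : Fin n → Bool → ℝ} {κ η : ℝ} (hκ : 0 < κ) (hκ1 : κ ≤ 1)
    (hκp : ∀ i j, κ ≤ p i j) (hp : ∀ i, ∑ j, p i j = 1) {k M Γ : ℕ} (hη : 0 < η)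
    (hβ : ((1 + η) ^ k - 1) / κ ^ k ≤ 1 / 8) {ρ : ℝ}
    (hρ : ρ * (1 + η) ^ k = 1 - 7 * (((1 + η) ^ k - 1) / κ ^ k))
    (hgen : ∀ u : Fin D → ℤ, (∀ d, |u d| ≤ R d) → ∀ T : Finset (Fin n), T.card ≤ Γ →
      ∃ S S' : Finset (Fin n), Disjoint S T ∧ Disjoint S' T ∧
        S.card + S'.card ≤ k ∧ ∀ d, u d = ∑ i ∈ S, v i d - ∑ i ∈ S', v i d)
    {A₀ : Set (Fin n → Bool)} {F : ℝ} (hF : 0 < F)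
    (hA₀ : F ≤ smeas (prodMeas p) A₀ * smeas (prodMeas p) A₀)
    (hΓ : 1 ≤ F * ρ ^ M * (1 + η) ^ Γ) :
    ∀ l : List (Fin D → ℤ), l.length ≤ M → (∀ u ∈ l, ∀ d, |u d| ≤ R d) →
      ∃ P A B, Extends R v A₀ l P A B ∧ P.card ≤ Γ ∧
        F * ρ ^ l.length * (1 + η) ^ P.card ≤ smeas (prodMeas p) A * smeas (prodMeas p) B := by
  set μ := prodMeas p with hμdef
  have hp0 : ∀ i j, 0 ≤ p i j := fun i j => hκ.le.trans (hκp i j)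
  have hμ : ∀ a, 0 ≤ μ a := prodMeas_nonneg hp0
  have hμ1 : ∀ A, smeas μ A ≤ 1 := fun A =>
    (smeas_le_sum hμ A).trans (sum_prodMeas hp).le
  have h1η : (1 : ℝ) < 1 + η := by linarith
  have hηk : 1 ≤ (1 + η) ^ k := one_le_pow₀ h1η.le
  have hκk : 0 < κ ^ k := pow_pos hκ k
  set E := (1 + η) ^ k - 1 with hE
  have hE0 : 0 ≤ E := by linarith
  set β := E / κ ^ k with hβdef
  have hβ0 : 0 ≤ β := by positivity
  have hρ0 : 0 < ρ := by
    by_contra h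
    nlinarith [not_lt.1 h]
  have hρ1 : ρ ≤ 1 := by nlinarith
  have hcard : ∀ (l : List (Fin D → ℤ)) (P : Finset (Fin n)) (A B : Set (Fin n → Bool)),
      l.length ≤ M → F * ρ ^ l.length * (1 + η) ^ P.card ≤ smeas μ A * smeas μ B →
      P.card ≤ Γ := by
    intro l P A B hl h
    have h1 : smeas μ A * smeas μ B ≤ 1 := mul_le_one₀ (hμ1 A) (smeas_nonneg hμ B) (hμ1 B)
    have h2 : F * ρ ^ M * (1 + η) ^ Γ ≤ F * ρ ^ l.length * (1 + η) ^ Γ :=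
      mul_le_mul_of_nonneg_right (mul_le_mul_of_nonneg_left
        (pow_le_pow_of_le_one hρ0.le hρ1 hl) hF.le) (by positivity)
    have h3 : F * ρ ^ l.length * (1 + η) ^ P.card ≤ F * ρ ^ l.length * (1 + η) ^ Γ := by
      linarith
    have h4 := le_of_mul_le_mul_left h3 (by positivity)
    exact (pow_le_pow_iff_right₀ h1η).1 h4
  intro l
  induction l with
  | nil =>
    intro _ _
    exact ⟨∅, A₀, A₀, Extends.refl R v A₀, by simp, by simpa using hA₀⟩
  | cons u l ih =>
    intro hl hul
    have hl' : l.length ≤ M := (Nat.le_succ _).trans hl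
    obtain ⟨P₁, A₁, B₁, hext₁, -, hF₁⟩ := ih hl' fun u hu => hul u (List.mem_cons_of_mem _ hu)
    obtain ⟨⟨P, A, B⟩, hext, hmax⟩ := Set.exists_max_image
      {x : Finset (Fin n) × Set (Fin n → Bool) × Set (Fin n → Bool) |
        Extends R v A₀ l x.1 x.2.1 x.2.2}
      (fun x => smeas μ x.2.1 * smeas μ x.2.2 / (1 + η) ^ x.1.card)
      (Set.toFinite _) ⟨(P₁, A₁, B₁), hext₁⟩
    replace hext : Extends R v A₀ l P A B := hext
    replace hmax : ∀ P' A' B', Extends R v A₀ l P' A' B' →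
        smeas μ A' * smeas μ B' / (1 + η) ^ P'.card
          ≤ smeas μ A * smeas μ B / (1 + η) ^ P.card :=
      fun P' A' B' h => hmax (P', A', B') h
    have hFP : F * ρ ^ l.length * (1 + η) ^ P.card ≤ smeas μ A * smeas μ B := by
      have h1 := hmax P₁ A₁ B₁ hext₁
      rw [← le_div_iff₀ (by positivity)] at hF₁ ⊢
      exact hF₁.trans h1
    have hP := hcard l P A B hl' hFP
    obtain ⟨S, S', hSP, hS'P, hSk, hu⟩ := hgen u (hul u List.mem_cons_self) P hP
    set K := S ∪ S' with hK
    have hKk : K.card ≤ k := (card_union_le _ _).trans hSk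
    have hPK : Disjoint P K := (disjoint_union_right.2 ⟨hSP.symm, hS'P.symm⟩)
    have hPKcard : (P ∪ K).card = P.card + K.card := card_union_of_disjoint hPK
    set α := smeas μ A with hα
    set b := smeas μ B with hb
    have hαb : 0 < α * b := lt_of_lt_of_le (by positivity) hFP
    have hα0 : 0 < α := lt_of_le_of_ne (smeas_nonneg hμ A) fun h => by
      rw [← h] at hαb; simp at hαb
    have hb0 : 0 < b := lt_of_le_of_ne (smeas_nonneg hμ B) fun h => by
      rw [← h] at hαb; simp at hαb
    have hle : ∀ A' B', Extends R v A₀ l (P ∪ K) A' B' →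
        smeas μ A' * smeas μ B' ≤ (1 + E) * (α * b) := by
      intro A' B' h
      have h1 := hmax _ _ _ h
      rw [hPKcard, div_le_div_iff₀ (by positivity) (by positivity), pow_add] at h1
      have h2 : (smeas μ A' * smeas μ B') * (1 + η) ^ P.card
          ≤ ((1 + η) ^ K.card * (α * b)) * (1 + η) ^ P.card := by linarith
      have h3 := le_of_mul_le_mul_right h2 (by positivity)
      refine h3.trans (mul_le_mul_of_nonneg_right ?_ hαb.le)
      have := pow_le_pow_right₀ h1η.le hKk
      linarith
    have hAle : ∀ σ, smeas μ (sectionAt K σ A) ≤ (1 + E) * α := by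
      intro σ
      obtain ⟨τ, hτ⟩ := exists_section_ge hp0 hp K B
      have h1 := hle _ _ (hext.section_section hv hPK σ τ)
      have h2 := mul_le_mul_of_nonneg_left hτ (smeas_nonneg hμ (sectionAt K σ A))
      have h3 : smeas μ (sectionAt K σ A) * b ≤ ((1 + E) * α) * b := by linarith
      exact le_of_mul_le_mul_right h3 hb0
    have hBle : ∀ τ, smeas μ (sectionAt K τ B) ≤ (1 + E) * b := by
      intro τ
      obtain ⟨σ, hσ⟩ := exists_section_ge hp0 hp K A
      have h1 := hle _ _ (hext.section_section hv hPK σ τ)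
      have h2 := mul_le_mul_of_nonneg_right hσ (smeas_nonneg hμ (sectionAt K τ B))
      have h3 : smeas μ (sectionAt K τ B) * α ≤ ((1 + E) * b) * α := by linarith
      exact le_of_mul_le_mul_right h3 hα0
    have hAge := section_ge_of_sections_le hκ hκ1 hE0 hκp hp hKk A hAle
    have hBge := section_ge_of_sections_le hκ hκ1 hE0 hκp hp hKk B hBle
    set σ₁ : Fin n → Bool := fun i => decide (i ∈ S) with hσ₁
    set σ₂ : Fin n → Bool := fun i => decide (i ∈ S') with hσ₂
    have hfin := inter_section_ge hβdef hκk (pow_le_one₀ hκ.le hκ1) hE0 hβ hα0 hb0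
      (hAge σ₁) (hAge σ₂) (smeas_union_add_inter μ _ _) (hBge fun _ => false)
      (hBge fun _ => true) (hle _ _ (hext.union_section hR hPK σ₁ σ₂)) (smeas_nonneg hμ _)
    have hFnew : F * ρ ^ (u :: l).length * (1 + η) ^ (P ∪ K).card
        ≤ smeas μ (sectionAt K σ₁ A ∩ sectionAt K σ₂ A) *
          smeas μ (sectionAt K (fun _ => true) B) := by
      refine le_trans ?_ hfin
      rw [← hρ, List.length_cons, hPKcard]
      calc F * ρ ^ (l.length + 1) * (1 + η) ^ (P.card + K.card)
          = (ρ * (1 + η) ^ K.card) * (F * ρ ^ l.length * (1 + η) ^ P.card) := by ring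
        _ ≤ (ρ * (1 + η) ^ k) * (α * b) := by
            refine mul_le_mul ?_ hFP (by positivity) (by positivity)
            exact mul_le_mul_of_nonneg_left (pow_le_pow_right₀ h1η.le hKk) hρ0.le
    exact ⟨P ∪ K, _, _, hext.inter_section hv hPK hu, hcard _ _ _ _ hl hFnew, hFnew⟩

end Growth

/-! ### Lists whose subset sums cover a box -/

lemma covers_cons {l : List ℤ} {N r : ℤ} (hr : r ≤ N + 1)
    (hl : ∀ y, 0 ≤ y → y ≤ N → ∃ l' : List ℤ, l'.Sublist l ∧ l'.sum = y) :
    ∀ y, 0 ≤ y → y ≤ N + r → ∃ l' : List ℤ, l'.Sublist (r :: l) ∧ l'.sum = y := by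
  intro y h0 h1
  by_cases hy : y ≤ N
  · obtain ⟨l', h, h'⟩ := hl y h0 hy
    exact ⟨l', h.cons r, h'⟩
  · obtain ⟨l', h, h'⟩ := hl (y - r) (by lia) (by lia)
    exact ⟨r :: l', h.cons_cons r, by rw [List.sum_cons, h']; ring⟩

lemma exists_covers_lt_two_pow (L : ℕ) : ∀ R : ℤ, 0 ≤ R → R < 2 ^ L →
    ∃ l : List ℤ, l.length ≤ L ∧ (∀ x ∈ l, |x| ≤ R) ∧
      ∀ y, 0 ≤ y → y ≤ R → ∃ l' : List ℤ, l'.Sublist l ∧ l'.sum = y := by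
  induction L with
  | zero =>
    intro R h0 h1
    exact ⟨[], le_rfl, by simp, fun y hy hyR => ⟨[], List.Sublist.slnil, by simp at h1 ⊢; lia⟩⟩
  | succ L ih =>
    intro R h0 h1
    rw [pow_succ] at h1
    obtain ⟨l, hl, hx, hc⟩ := ih (R / 2) (by lia) (by lia)
    refine ⟨(R - R / 2) :: l, by simpa using hl, ?_, ?_⟩
    · intro x hxl
      rcases List.mem_cons.1 hxl with rfl | hxl
      · rw [abs_le]; lia
      · exact (hx x hxl).trans (by lia)
    · intro y hy hyR
      exact covers_cons (by lia) hc y hy (by lia)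

lemma exists_covers_mul {L : ℕ} {R : ℤ} (hR : 0 ≤ R) (hRL : R < 2 ^ L) (m : ℕ) :
    ∃ l : List ℤ, l.length ≤ L + m ∧ (∀ x ∈ l, |x| ≤ R) ∧
      ∀ y, 0 ≤ y → y ≤ R + m * R → ∃ l' : List ℤ, l'.Sublist l ∧ l'.sum = y := by
  induction m with
  | zero => simpa using exists_covers_lt_two_pow L R hR hRL
  | succ m ih =>
    obtain ⟨l, hl, hx, hc⟩ := ih
    refine ⟨R :: l, by simpa [← add_assoc] using hl, ?_, ?_⟩
    · intro x hxl
      rcases List.mem_cons.1 hxl with rfl | hxl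
      · exact (abs_of_nonneg hR).le
      · exact hx x hxl
    · intro y hy hyR
      refine covers_cons ?_ hc y hy (by push_cast at hyR; linarith)
      have : 0 ≤ (m : ℤ) * R := by positivity
      linarith

lemma exists_covers_vector {D L : ℕ} {R : Fin D → ℤ} (hR : ∀ d, 0 ≤ R d)
    (hRL : ∀ d, R d < 2 ^ L) :
    ∃ l : List (Fin D → ℤ), l.length ≤ 2 * D * L ∧ (∀ u ∈ l, ∀ d, |u d| ≤ R d) ∧
      ∀ y : Fin D → ℤ, (∀ d, 0 ≤ y d) → (∀ d, y d ≤ L * R d) →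
        ∃ l' : List (Fin D → ℤ), l'.Sublist l ∧ l'.sum = y := by
  have key : ∀ s : Finset (Fin D), ∃ l : List (Fin D → ℤ), l.length ≤ 2 * s.card * L ∧
      (∀ u ∈ l, ∀ d, |u d| ≤ R d) ∧
      ∀ y : Fin D → ℤ, (∀ d, 0 ≤ y d) → (∀ d, y d ≤ L * R d) → (∀ d ∉ s, y d = 0) →
        ∃ l' : List (Fin D → ℤ), l'.Sublist l ∧ l'.sum = y := by
    intro s
    induction s using Finset.induction_on with
    | empty =>
      exact ⟨[], by simp, by simp, fun y _ _ h => ⟨[], List.Sublist.slnil, by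
        ext d; simp [h d]⟩⟩
    | insert e s he ih =>
      obtain ⟨l, hl, hu, hc⟩ := ih
      obtain ⟨m, hm, hx, hmc⟩ := exists_covers_mul (hR e) (hRL e) L
      refine ⟨m.map (fun x => (Pi.single e x : Fin D → ℤ)) ++ l, ?_, ?_, ?_⟩
      · rw [List.length_append, List.length_map, Finset.card_insert_of_notMem he]
        calc _ ≤ (L + L) + 2 * s.card * L := add_le_add hm hl
          _ = _ := by ring
      · intro u h d
        rcases List.mem_append.1 h with h | h
        · obtain ⟨x, hxm, rfl⟩ := List.mem_map.1 h
          by_cases hd : d = e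
          · subst hd; simpa using hx x hxm
          · simpa [Pi.single_eq_of_ne hd] using hR d
        · exact hu u h d
      · intro y h0 h1 h2
        obtain ⟨l₁, hl₁, hs₁⟩ := hmc (y e) (h0 e) (by linarith [h1 e, hR e])
        obtain ⟨l₂, hl₂, hs₂⟩ := hc (Function.update y e 0)
          (fun d => by
            by_cases hd : d = e
            · subst hd; simp
            · simpa [Function.update_of_ne hd] using h0 d)
          (fun d => by
            by_cases hd : d = e
            · subst hd; simpa using mul_nonneg (Int.natCast_nonneg L) (hR d)
            · simpa [Function.update_of_ne hd] using h1 d)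
          (fun d hds => by
            by_cases hd : d = e
            · subst hd; simp
            · simpa [Function.update_of_ne hd] using h2 d (by simp [hd, hds]))
        refine ⟨l₁.map (fun x => (Pi.single e x : Fin D → ℤ)) ++ l₂, (hl₁.map _).append hl₂, ?_⟩
        have hmap : (l₁.map (fun x => (Pi.single e x : Fin D → ℤ))).sum = Pi.single e l₁.sum := by
          clear hl₁ hs₁
          induction l₁ with
          | nil => simp
          | cons x t ih => simp [ih, Pi.single_add]
        rw [List.sum_append, hmap, hs₁, hs₂]
        ext d
        by_cases hd : d = e
        · subst hd; simp
        · simp [Pi.single_eq_of_ne hd, Function.update_of_ne hd]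
  obtain ⟨l, hl, hu, hc⟩ := key Finset.univ
  exact ⟨l, by simpa using hl, hu, fun y h0 h1 => hc y h0 h1 (by simp)⟩

/-! ### Shifting the mean of a product measure -/

lemma exists_weights_of_list {n D k Γ : ℕ} {R : Fin D → ℤ} {v : Fin n → Fin D → ℤ} {τ : ℝ}
    (hgen : ∀ u : Fin D → ℤ, (∀ d, |u d| ≤ R d) → ∀ T : Finset (Fin n), T.card ≤ Γ →
      ∃ S S' : Finset (Fin n), Disjoint S S' ∧ Disjoint S T ∧ Disjoint S' T ∧
        S.card + S'.card ≤ k ∧ ∀ d, u d = ∑ i ∈ S, v i d - ∑ i ∈ S', v i d) (hτ : 0 ≤ τ) :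
    ∀ (l : List (ℝ × (Fin D → ℤ))) (T : Finset (Fin n)),
      (∀ c ∈ l, |c.1| ≤ τ ∧ ∀ d, |c.2 d| ≤ R d) → T.card + k * l.length ≤ Γ →
      ∃ t : Fin n → ℝ, (∀ i, |t i| ≤ τ) ∧ (∀ i ∈ T, t i = 0) ∧
        ∀ d, ∑ i, t i * v i d = (l.map fun c => c.1 * (c.2 d : ℝ)).sum := by
  intro l
  induction l with
  | nil => exact fun T _ _ => ⟨0, fun _ => by simpa using hτ, by simp, by simp⟩
  | cons c l ih =>
    intro T hl hT
    obtain ⟨hc, hcR⟩ := hl c (by simp)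
    rw [List.length_cons] at hT
    obtain ⟨S, S', hSS, hST, hST', hcard, hu⟩ := hgen c.2 hcR T (by lia)
    obtain ⟨t, ht, htT, hsum⟩ := ih (T ∪ (S ∪ S')) (fun c' h => hl c' (by simp [h])) (by
      have h₁ := Finset.card_union_le T (S ∪ S')
      have h₂ := Finset.card_union_le S S'
      lia)
    refine ⟨fun i => t i + c.1 * ((if i ∈ S then 1 else 0) - if i ∈ S' then 1 else 0),
      fun i => ?_, fun i hi => ?_, fun d => ?_⟩
    · by_cases h : i ∈ S
      · have : i ∉ S' := Finset.disjoint_left.1 hSS h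
        simp only [h, this, if_true, if_false]
        rw [htT i (by simp [h])]
        simpa using hc
      · by_cases h' : i ∈ S'
        · simp only [h, h', if_true, if_false]
          rw [htT i (by simp [h'])]
          simpa using hc
        · simpa [h, h'] using ht i
    · have h₁ : i ∉ S := fun h => Finset.disjoint_left.1 hST h hi
      have h₂ : i ∉ S' := fun h => Finset.disjoint_left.1 hST' h hi
      simpa [h₁, h₂] using htT i (by simp [hi])
    · rw [List.map_cons, List.sum_cons, ← hsum d, hu d]
      push_cast
      simp only [add_mul, Finset.sum_add_distrib, mul_sub, sub_mul, Finset.sum_sub_distrib,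
        mul_ite, ite_mul, mul_one, mul_zero, zero_mul, Finset.sum_ite_mem, Finset.univ_inter,
        ← Finset.mul_sum]
      ring

/-- Any vector whose scaled norm is at most `m * τ` is a combination, with coefficients at most
`τ`, of the vectors of a robustly generating family, avoiding a prescribed small set. -/
lemma exists_weights {n D k Γ : ℕ} {R : Fin D → ℤ} (hR : ∀ d, 0 < R d)
    {v : Fin n → Fin D → ℤ} {τ : ℝ}
    (hgen : ∀ u : Fin D → ℤ, (∀ d, |u d| ≤ R d) → ∀ T : Finset (Fin n), T.card ≤ Γ →
      ∃ S S' : Finset (Fin n), Disjoint S S' ∧ Disjoint S T ∧ Disjoint S' T ∧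
        S.card + S'.card ≤ k ∧ ∀ d, u d = ∑ i ∈ S, v i d - ∑ i ∈ S', v i d) (hτ : 0 ≤ τ)
    {m : ℕ} (hm : 0 < m) (T : Finset (Fin n)) (hT : T.card + k * (D * m) ≤ Γ)
    (z : Fin D → ℝ) (hz : ∀ d, |z d| ≤ m * τ * R d) :
    ∃ t : Fin n → ℝ, (∀ i, |t i| ≤ τ) ∧ (∀ i ∈ T, t i = 0) ∧
      ∀ d, ∑ i, t i * v i d = z d := by
  have hm' : (0 : ℝ) < m := by exact_mod_cast hm
  have hR' : ∀ d, (0 : ℝ) < R d := fun d => by exact_mod_cast hR d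
  obtain ⟨t, h₁, h₂, h₃⟩ := exists_weights_of_list hgen hτ
    ((List.finRange D).flatMap fun d => List.replicate m (z d / (m * R d), Pi.single d (R d)))
    T (by
      intro c hc
      obtain ⟨d, -, hd⟩ := List.mem_flatMap.1 hc
      obtain rfl := List.eq_of_mem_replicate hd
      refine ⟨?_, fun e => ?_⟩
      · simp only
        rw [abs_div, abs_of_pos (mul_pos hm' (hR' d)), div_le_iff₀ (mul_pos hm' (hR' d))]
        linarith [hz d]
      · by_cases he : e = d
        · subst he; simp [abs_of_pos (hR e)]
        · simpa [Pi.single_eq_of_ne he] using (hR e).le)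
    (by simpa using hT)
  refine ⟨t, h₁, h₂, fun d => ?_⟩
  rw [h₃ d, List.map_flatMap, List.flatMap_def, List.sum_flatten, List.map_map]
  simp only [Function.comp_def, List.map_replicate, List.sum_replicate]
  rw [← Fin.sum_univ_def, Finset.sum_eq_single d]
  · have := (hR' d).ne'
    simp only [Pi.single_eq_same, nsmul_eq_mul]
    field_simp
  · intro e _ he
    simp [Pi.single_eq_of_ne he.symm]
  · simp

lemma arrEval_capArr {n D : ℕ} (v : Fin n → Fin D → ℤ) (r : Fin n → Bool × Bool) (d : Fin D) :
    arrEval (capArr v) r d = capSum v Finset.univ (fun i => (r i).1) (fun i => (r i).2) d :=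
  rfl

lemma abs_capSum_sub_le {n D : ℕ} {R : Fin D → ℤ} {v : Fin n → Fin D → ℤ}
    (hv : ∀ i d, |v i d| ≤ R d) (K : Finset (Fin n)) (a b a' b' : Fin n → Bool) (d : Fin D) :
    |capSum v K a b d - capSum v K a' b' d| ≤ (hammingDist a a' + hammingDist b b') * R d := by
  unfold capSum hammingDist
  rw [← Finset.sum_sub_distrib]
  refine (Finset.abs_sum_le_sum_abs _ _).trans ?_
  rw [add_mul, ← nsmul_eq_mul, ← nsmul_eq_mul, ← Finset.sum_const, ← Finset.sum_const,
    Finset.sum_filter, Finset.sum_filter, ← Finset.sum_add_distrib]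
  refine (Finset.sum_le_sum_of_subset_of_nonneg (Finset.subset_univ K)
    fun _ _ _ => abs_nonneg _).trans (Finset.sum_le_sum fun i _ => ?_)
  have h := hv i d
  have h₀ := abs_nonneg (v i d)
  have hR := h₀.trans h
  cases a i <;> cases b i <;> cases a' i <;> cases b' i <;> simp <;> linarith

lemma hammingDist_pair_le {n : ℕ} {P : Finset (Fin n)} {r g : Fin n → Bool × Bool}
    {a b : Fin n → Bool} (ha : ∀ i ∉ P, (g i).1 = a i) (hb : ∀ i ∉ P, (g i).2 = b i) :
    hammingDist r g ≤
      hammingDist (fun i => (r i).1) a + hammingDist (fun i => (r i).2) b + P.card := by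
  unfold hammingDist
  refine (Finset.card_le_card (t := (({i | (r i).1 ≠ a i} : Finset (Fin n)) ∪
    ({i | (r i).2 ≠ b i} : Finset (Fin n))) ∪ P) fun i hi => ?_).trans
    ((Finset.card_union_le _ _).trans
      (Nat.add_le_add_right (Finset.card_union_le _ _) _))
  simp only [Finset.mem_filter, Finset.mem_univ, true_and, Finset.mem_union] at hi ⊢
  by_cases hP : i ∈ P
  · exact Or.inr hP
  · left
    rw [← ha i hP, ← hb i hP]
    by_contra! h
    exact hi (Prod.ext h.1 h.2)

/-- Perturb the weights by `t i` on the diagonal and by `-t i` off it; the marginals are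
unchanged. -/
def tilt {n : ℕ} (q : Fin n → Bool × Bool → ℝ) (t : Fin n → ℝ) (i : Fin n) (jj : Bool × Bool) :
    ℝ :=
  q i jj + if jj.1 = jj.2 then t i else -t i

lemma sum_tilt_fst {n : ℕ} {q : Fin n → Bool × Bool → ℝ} {p : Fin n → Bool → ℝ}
    (hp : ∀ i j, ∑ j', q i (j, j') = p i j) (t : Fin n → ℝ) (i : Fin n) (j : Bool) :
    ∑ x with x.1 = j, tilt q t i x = p i j := by
  rw [← hp i j, Finset.sum_filter, Fintype.sum_prod_type]
  cases j <;> simp [tilt] <;> ring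

lemma sum_tilt_snd {n : ℕ} {q : Fin n → Bool × Bool → ℝ} {p : Fin n → Bool → ℝ}
    (hp : ∀ i j, ∑ j', q i (j', j) = p i j) (t : Fin n → ℝ) (i : Fin n) (j : Bool) :
    ∑ x with x.2 = j, tilt q t i x = p i j := by
  rw [← hp i j, Finset.sum_filter, Fintype.sum_prod_type]
  cases j <;> simp [tilt] <;> ring

lemma sum_tilt {n : ℕ} {q : Fin n → Bool × Bool → ℝ} (hq : ∀ i, ∑ jj, q i jj = 1)
    (t : Fin n → ℝ) (i : Fin n) : ∑ jj, tilt q t i jj = 1 := by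
  rw [← hq i, Fintype.sum_prod_type, Fintype.sum_prod_type]
  simp [tilt]; ring

lemma tilt_nonneg {n : ℕ} {q : Fin n → Bool × Bool → ℝ} {κ : ℝ} (hq : ∀ i jj, κ ≤ q i jj)
    {t : Fin n → ℝ} (ht : ∀ i, |t i| ≤ κ) (i : Fin n) (jj : Bool × Bool) :
    0 ≤ tilt q t i jj := by
  have := abs_le.1 (ht i)
  have := hq i jj
  unfold tilt; split_ifs <;> linarith

lemma tilt_le {n : ℕ} (q : Fin n → Bool × Bool → ℝ) {τ : ℝ}
    {t : Fin n → ℝ} (ht : ∀ i, |t i| ≤ τ) (i : Fin n) (jj : Bool × Bool) :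
    tilt q t i jj ≤ q i jj + τ := by
  have := abs_le.1 (ht i)
  unfold tilt; split_ifs <;> linarith

lemma exists_target_near {n D L h : ℕ} {R : Fin D → ℤ} {v : Fin n → Fin D → ℤ}
    (hR : ∀ d, 0 ≤ R d) (hv : ∀ i d, |v i d| ≤ R d) {A₀ : Set (Fin n → Bool)} {l : List (Fin D → ℤ)}
    {P : Finset (Fin n)} {A B : Set (Fin n → Bool)} {x₀ : Fin D → ℤ}
    (hext : ∀ a ∈ A, ∀ b ∈ B, ∀ l' : List (Fin D → ℤ), l'.Sublist l → ∃ a' ∈ A₀, ∃ b' ∈ A₀,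
      (∀ i, i ∉ P → a' i = a i) ∧ (∀ i, i ∉ P → b' i = b i) ∧
      ∀ d, capSum v P a' b' d = x₀ d + l'.sum d)
    (hl : ∀ y : Fin D → ℤ, (∀ d, 0 ≤ y d) → (∀ d, y d ≤ L * R d) →
        ∃ l' : List (Fin D → ℤ), l'.Sublist l ∧ l'.sum = y)
    {w : Fin D → ℤ} {m : ℝ} (hm : m + 2 * h ≤ L / 2) {r : Fin n → Bool × Bool}
    (hr : ∀ d, |(capSum v Pᶜ (fun i => (r i).1) (fun i => (r i).2) d : ℝ)
      - (w d - x₀ d - L / 2 * R d)| ≤ m * R d)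
    (hA : ∃ a' ∈ A, hammingDist (fun i => (r i).1) a' ≤ h)
    (hB : ∃ b' ∈ B, hammingDist (fun i => (r i).2) b' ≤ h) :
    ∃ g ∈ {r : Fin n → Bool × Bool | (fun i => (r i).1) ∈ A₀ ∧ (fun i => (r i).2) ∈ A₀ ∧
      ∀ d, arrEval (capArr v) r d = w d}, hammingDist r g ≤ 2 * h + P.card := by
  obtain ⟨a', ha', hda⟩ := hA
  obtain ⟨b', hb', hdb⟩ := hB
  have hy : ∀ d, 0 ≤ w d - x₀ d - capSum v Pᶜ a' b' d ∧
      w d - x₀ d - capSum v Pᶜ a' b' d ≤ L * R d := by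
    intro d
    have h₁ := abs_le.1 (hr d)
    have h₂ := abs_capSum_sub_le hv Pᶜ (fun i => (r i).1) (fun i => (r i).2) a' b' d
    rw [← @Int.cast_le ℝ] at h₂
    push_cast at h₂
    have hab : (hammingDist (fun i => (r i).1) a' : ℝ) + hammingDist (fun i => (r i).2) b'
        ≤ 2 * h := by
      have : hammingDist (fun i => (r i).1) a' + hammingDist (fun i => (r i).2) b' ≤ 2 * h := by
        lia
      exact_mod_cast this
    have hRd : (0 : ℝ) ≤ R d := by exact_mod_cast hR d
    have h₃ := abs_le.1 (h₂.trans (mul_le_mul_of_nonneg_right hab hRd))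
    have h₄ := mul_le_mul_of_nonneg_right hm hRd
    constructor <;> rw [← @Int.cast_le ℝ] <;> push_cast <;> linarith
  obtain ⟨l', hl', hs⟩ := hl _ (fun d => (hy d).1) (fun d => (hy d).2)
  obtain ⟨a, ha, b, hb, haP, hbP, hsum⟩ := hext a' ha' b' hb' l' hl'
  refine ⟨fun i => (a i, b i), ⟨ha, hb, fun d => ?_⟩, ?_⟩
  · rw [arrEval_capArr, ← Finset.union_compl P, capSum_union v disjoint_compl_right, hsum d, hs,
      capSum_congr v (K := Pᶜ) (a' := a') (b' := b') (fun i hi => haP i (Finset.mem_compl.1 hi))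
        (fun i hi => hbP i (Finset.mem_compl.1 hi))]
    ring
  · have := hammingDist_pair_le (r := r) (g := fun i => (a i, b i)) haP hbP
    lia

/-- The probability that the intersection vector outside `P` is far from its mean. -/
lemma smeas_capSum_deviation_le {n D : ℕ} {R : Fin D → ℤ} (hR : ∀ d, 0 < R d)
    {v : Fin n → Fin D → ℤ} (hv : ∀ i d, |v i d| ≤ R d) {q : Fin n → Bool × Bool → ℝ}
    (hq0 : ∀ i jj, 0 ≤ q i jj) (hq : ∀ i, ∑ jj, q i jj = 1) (K : Finset (Fin n)) {lam : ℝ}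
    (h0 : 0 ≤ lam) (h1 : lam ≤ 1) (d : Fin D) :
    smeas (prodMeas q) {r | ¬ |(capSum v K (fun i => (r i).1) (fun i => (r i).2) d : ℝ)
      - ∑ i ∈ K, v i d * q i (true, true)| ≤ lam * n * R d} ≤
      2 * Real.exp (-(lam ^ 2 / 16 * n)) := by
  have hRd : (0 : ℝ) < R d := by exact_mod_cast hR d
  set g : Fin n → Bool × Bool → ℝ := fun i jj =>
    if i ∈ K then (if jj.1 ∧ jj.2 then (v i d : ℝ) / R d else 0) else 0 with hg
  have hg1 : ∀ i jj, |g i jj| ≤ 1 := by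
    intro i jj
    simp only [hg]
    split_ifs
    · rw [abs_div, abs_of_pos hRd, div_le_one hRd]
      exact_mod_cast hv i d
    · simp
    · simp
  have hmean : ∑ i, ∑ j, q i j * g i j = (∑ i ∈ K, v i d * q i (true, true)) / R d := by
    rw [Finset.sum_div, ← Finset.univ_inter K, ← Finset.sum_ite_mem]
    refine Finset.sum_congr rfl fun i _ => ?_
    rw [Fintype.sum_prod_type]
    by_cases h : i ∈ K
    · simp [hg, h]; ring
    · simp [hg, h]
  have hval : ∀ r : Fin n → Bool × Bool, ∑ i, g i (r i) =
      (capSum v K (fun i => (r i).1) (fun i => (r i).2) d : ℝ) / R d := by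
    intro r
    rw [capSum, Int.cast_sum, Finset.sum_div, ← Finset.univ_inter K, ← Finset.sum_ite_mem]
    refine Finset.sum_congr rfl fun i _ => ?_
    by_cases h : i ∈ K
    · simp only [hg, h, if_true]; split_ifs <;> simp
    · simp [hg, h]
  have hu := smeas_deviation_le hq0 hq g hg1 h0 h1
  have hl := smeas_deviation_le hq0 hq (fun i j => -g i j) (by simpa using hg1) h0 h1
  have hμ := prodMeas_nonneg hq0
  refine (smeas_mono hμ (B := _ ∪ _) fun r hr => ?_).trans
    ((smeas_union_le hμ _ _).trans ((add_le_add hu hl).trans_eq (two_mul _).symm))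
  by_contra hcon
  simp only [Set.mem_union, Set.mem_ofPred_eq, not_or, not_le, hval, hmean, mul_neg,
    Finset.sum_neg_distrib] at hcon
  refine hr ?_
  obtain ⟨h₁, h₂⟩ := hcon
  rw [← sub_div, div_lt_iff₀ hRd] at h₁
  rw [sub_neg_eq_add, ← neg_div, ← add_div, div_lt_iff₀ hRd] at h₂
  rw [abs_le]
  constructor <;> linarith

lemma half_le_smeas_near_target {n D L h : ℕ} {R : Fin D → ℤ} (hR : ∀ d, 0 < R d)
    {v : Fin n → Fin D → ℤ} (hv : ∀ i d, |v i d| ≤ R d) {A₀ : Set (Fin n → Bool)}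
    {l : List (Fin D → ℤ)} {P : Finset (Fin n)} {A B : Set (Fin n → Bool)} {x₀ : Fin D → ℤ}
    (hext : ∀ a ∈ A, ∀ b ∈ B, ∀ l' : List (Fin D → ℤ), l'.Sublist l → ∃ a' ∈ A₀, ∃ b' ∈ A₀,
      (∀ i, i ∉ P → a' i = a i) ∧ (∀ i, i ∉ P → b' i = b i) ∧
      ∀ d, capSum v P a' b' d = x₀ d + l'.sum d)
    (hl : ∀ y : Fin D → ℤ, (∀ d, 0 ≤ y d) → (∀ d, y d ≤ L * R d) →
        ∃ l' : List (Fin D → ℤ), l'.Sublist l ∧ l'.sum = y)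
    {w : Fin D → ℤ} {q : Fin n → Bool × Bool → ℝ} {p : Fin n → Bool → ℝ}
    (hq0 : ∀ i jj, 0 ≤ q i jj) (hq : ∀ i, ∑ jj, q i jj = 1)
    (hp1 : ∀ i j, ∑ x with x.1 = j, q i x = p i j)
    (hp2 : ∀ i j, ∑ x with x.2 = j, q i x = p i j)
    (hw : ∀ d, (w d - x₀ d - L / 2 * R d : ℝ) = ∑ i ∈ Pᶜ, v i d * q i (true, true))
    {lam f : ℝ} (h0 : 0 ≤ lam) (h1 : lam ≤ 1) (hm : lam * n + 2 * h ≤ L / 2)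
    (hA : smeas (prodMeas p) {a | ¬ ∃ a' ∈ A, (hammingDist a a' : ℝ) ≤ h} ≤ f)
    (hB : smeas (prodMeas p) {b | ¬ ∃ b' ∈ B, (hammingDist b b' : ℝ) ≤ h} ≤ f)
    (hf : 2 * f + D * (2 * Real.exp (-(lam ^ 2 / 16 * n))) ≤ 1 / 2) :
    1 / 2 ≤ smeas (prodMeas q) {r | ∃ g ∈ {r : Fin n → Bool × Bool |
      (fun i => (r i).1) ∈ A₀ ∧ (fun i => (r i).2) ∈ A₀ ∧
        ∀ d, arrEval (capArr v) r d = w d}, hammingDist r g ≤ 2 * h + P.card} := by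
  have hμ := prodMeas_nonneg hq0
  have hcompl := smeas_compl_add (prodMeas q) {r | ∃ g ∈ {r : Fin n → Bool × Bool |
      (fun i => (r i).1) ∈ A₀ ∧ (fun i => (r i).2) ∈ A₀ ∧
        ∀ d, arrEval (capArr v) r d = w d}, hammingDist r g ≤ 2 * h + P.card}
  rw [sum_prodMeas hq] at hcompl
  rw [← smeas_map q p Prod.fst hp1] at hA
  rw [← smeas_map q p Prod.snd hp2] at hB
  have hdev := fun d => smeas_capSum_deviation_le hR hv hq0 hq Pᶜ h0 h1 d
  have hD := (smeas_iUnion_le hμ _).trans (Finset.sum_le_sum fun d _ => hdev d)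
  rw [Finset.sum_const, Finset.card_univ, Fintype.card_fin, nsmul_eq_mul] at hD
  have hAB := (smeas_union_le hμ _ _).trans (add_le_add hA hB)
  have hbad := (smeas_union_le hμ _ _).trans (add_le_add hAB hD)
  have hsub := (smeas_mono hμ (A := {r | ∃ g ∈ {r : Fin n → Bool × Bool |
      (fun i => (r i).1) ∈ A₀ ∧ (fun i => (r i).2) ∈ A₀ ∧
        ∀ d, arrEval (capArr v) r d = w d}, hammingDist r g ≤ 2 * h + P.card}ᶜ)
    fun r hr => ?_).trans hbad
  · linarith
  · by_contra hcon
    simp only [Set.mem_union, Set.mem_iUnion, Set.mem_ofPred_eq, not_or, not_not, not_exists,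
      Nat.cast_le] at hcon
    push Not at hcon
    obtain ⟨⟨h₁, h₂⟩, h₃⟩ := hcon
    exact hr (exists_target_near (fun d => (hR d).le) hv hext hl hm
      (fun d => by rw [hw d]; exact h₃ d) h₁ h₂)

lemma arrExp_capArr {n D : ℕ} (v : Fin n → Fin D → ℤ) {q : Fin n → Bool × Bool → ℝ}
    (hq : ∀ i, ∑ jj, q i jj = 1) (d : Fin D) :
    arrExp (capArr v) (prodMeas q) d = ∑ i, v i d * q i (true, true) := by
  simp only [arrExp, arrEval, Int.cast_sum, Finset.mul_sum]
  rw [Finset.sum_comm]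
  refine Finset.sum_congr rfl fun i _ => ?_
  rw [sum_prodMeas_mul_apply hq i fun jj => ((capArr v i jj d : ℤ) : ℝ), Fintype.sum_prod_type]
  simp [capArr, mul_comm]

lemma half_mul_pow_le_smeas_target {n D k L Γ Γ' m h : ℕ} {R : Fin D → ℤ}
    (hR : ∀ d, 0 < R d) (hRL : ∀ d, R d < 2 ^ L) {v : Fin n → Fin D → ℤ}
    (hv : ∀ i d, |v i d| ≤ R d) {q : Fin n → Bool × Bool → ℝ} {p : Fin n → Bool → ℝ} {κ : ℝ}
    (hκ : 0 < κ) (hκ1 : κ ≤ 1) (hqκ : ∀ i jj, κ ≤ q i jj) (hq : ∀ i, ∑ jj, q i jj = 1)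
    (hp1 : ∀ i j, ∑ j', q i (j, j') = p i j) (hp2 : ∀ i j, ∑ j', q i (j', j) = p i j)
    (hgen : ∀ u : Fin D → ℤ, (∀ d, |u d| ≤ R d) → ∀ T : Finset (Fin n), T.card ≤ Γ' →
      ∃ S S' : Finset (Fin n), Disjoint S S' ∧ Disjoint S T ∧ Disjoint S' T ∧
        S.card + S'.card ≤ k ∧ ∀ d, u d = ∑ i ∈ S, v i d - ∑ i ∈ S', v i d)
    {η ρ : ℝ} (hη : 0 < η) (hβ : ((1 + η) ^ k - 1) / κ ^ k ≤ 1 / 8)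
    (hρ : ρ * (1 + η) ^ k = 1 - 7 * (((1 + η) ^ k - 1) / κ ^ k)) (hρ0 : 0 ≤ ρ) (hρ1 : ρ ≤ 1)
    {A₀ : Set (Fin n → Bool)} {F : ℝ} (hF : 0 < F)
    (hA₀ : F ≤ smeas (prodMeas p) A₀ * smeas (prodMeas p) A₀)
    (hΓ : 1 ≤ F * ρ ^ (2 * D * L) * (1 + η) ^ Γ)
    {w : Fin D → ℤ} {Z τ x lam s : ℝ}
    (hw : ∀ d, |(w d : ℝ) - arrExp (capArr v) (prodMeas q) d| ≤ Z * R d)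
    (hm0 : 0 < m) (hm : Γ + k * (D * m) ≤ Γ') (hZ : Z + 2 * Γ + L / 2 ≤ m * τ)
    (hτ : 0 ≤ τ) (hτκ : τ ≤ κ) (hx : 0 < x) (hx1 : x ≤ 1)
    (hlam0 : 0 ≤ lam) (hlam1 : lam ≤ 1) (hs : 0 ≤ s) (hlam : lam * n + 2 * h ≤ L / 2)
    (hf : 2 * ((1 + η) ^ Γ * Real.exp (-(s * h) + s ^ 2 / 4 * n)) +
      D * (2 * Real.exp (-(lam ^ 2 / 16 * n))) ≤ 1 / 2) :
    1 / 2 * x ^ (2 * h + Γ) ≤ (1 + (τ + x) / κ) ^ n * smeas (prodMeas q)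
      {r : Fin n → Bool × Bool | (fun i => (r i).1) ∈ A₀ ∧ (fun i => (r i).2) ∈ A₀ ∧
        ∀ d, arrEval (capArr v) r d = w d} := by
  have hR0 : ∀ d, 0 ≤ R d := fun d => (hR d).le
  have hκp : ∀ i j, κ ≤ p i j := fun i j => by
    rw [← hp1 i j, Fintype.sum_bool]
    linarith [hqκ i (j, true), hqκ i (j, false)]
  have hp : ∀ i, ∑ j, p i j = 1 := fun i => by
    rw [← hq i, Fintype.sum_prod_type]
    exact Finset.sum_congr rfl fun j _ => (hp1 i j).symm
  have hp0 : ∀ i j, 0 ≤ p i j := fun i j => hκ.le.trans (hκp i j)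
  have hμ := prodMeas_nonneg hp0
  obtain ⟨l, hlL, hlR, hl⟩ := exists_covers_vector hR0 hRL
  obtain ⟨P, A, B, ⟨x₀, hx₀, hext⟩, hPΓ, hAB⟩ := exists_extends hR0 hv hκ hκ1 hκp hp hη hβ hρ
    (Γ := Γ) (fun u hu T hT => by
      obtain ⟨S, S', -, h₁, h₂, h₃, h₄⟩ := hgen u hu T (by lia)
      exact ⟨S, S', h₁, h₂, h₃, h₄⟩) hF hA₀ hΓ l hlL hlR
  -- the sets obtained are not too small
  have hη1 : 1 ≤ 1 + η := by linarith
  have hge : 1 ≤ smeas (prodMeas p) A * smeas (prodMeas p) B * (1 + η) ^ Γ := by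
    refine hΓ.trans (mul_le_mul_of_nonneg_right (le_trans ?_ hAB) (by positivity))
    calc F * ρ ^ (2 * D * L) ≤ F * ρ ^ l.length :=
          mul_le_mul_of_nonneg_left (pow_le_pow_of_le_one hρ0 hρ1 hlL) hF.le
      _ ≤ _ := le_mul_of_one_le_right (by positivity) (one_le_pow₀ hη1)
  have hle1 : ∀ S, smeas (prodMeas p) S ≤ 1 := fun S =>
    (smeas_le_sum hμ S).trans_eq (sum_prodMeas hp)
  have hfar : ∀ S, 1 ≤ smeas (prodMeas p) S * (1 + η) ^ Γ →
      smeas (prodMeas p) {a | ¬ ∃ a' ∈ S, (hammingDist a a' : ℝ) ≤ h} ≤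
        (1 + η) ^ Γ * Real.exp (-(s * h) + s ^ 2 / 4 * n) := by
    intro S hS
    have h₁ := smeas_far_mul_le (fun i j => hκ.trans_le (hκp i j)) hp S (s := s) (h := h) hs
    have h₂ := smeas_nonneg hμ {a | ¬ ∃ a' ∈ S, (hammingDist a a' : ℝ) ≤ h}
    calc _ ≤ smeas (prodMeas p) {a | ¬ ∃ a' ∈ S, (hammingDist a a' : ℝ) ≤ h} *
          (smeas (prodMeas p) S * (1 + η) ^ Γ) := le_mul_of_one_le_right h₂ hS
      _ = (1 + η) ^ Γ * (smeas (prodMeas p) {a | ¬ ∃ a' ∈ S, (hammingDist a a' : ℝ) ≤ h} *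
          smeas (prodMeas p) S) := by ring
      _ ≤ _ := mul_le_mul_of_nonneg_left h₁ (by positivity)
  have hpow : (0 : ℝ) ≤ (1 + η) ^ Γ := by positivity
  have hfA := hfar A (hge.trans (mul_le_mul_of_nonneg_right
    (mul_le_of_le_one_right (smeas_nonneg hμ A) (hle1 B)) hpow))
  have hfB := hfar B (hge.trans (mul_le_mul_of_nonneg_right
    (mul_le_of_le_one_left (smeas_nonneg hμ B) (hle1 A)) hpow))
  -- shift the mean so that the target becomes typical
  have hRr : ∀ d, (0 : ℝ) < R d := fun d => by exact_mod_cast hR d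
  have hPr : (P.card : ℝ) ≤ Γ := by exact_mod_cast hPΓ
  have hqs : ∀ i jj, q i jj ≤ 1 := fun i jj =>
    (hq i) ▸ Finset.single_le_sum (fun jj _ => hκ.le.trans (hqκ i jj)) (Finset.mem_univ jj)
  obtain ⟨t, htτ, htP, ht⟩ := exists_weights hR hgen hτ hm0 P (by lia)
    (fun d => w d - x₀ d - L / 2 * R d - ∑ i ∈ Pᶜ, v i d * q i (true, true)) (fun d => by
      have h₁ := hw d
      rw [arrExp_capArr v hq, ← Finset.sum_add_sum_compl P] at h₁
      have h₂ : |∑ i ∈ P, v i d * q i (true, true)| ≤ Γ * R d := by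
        refine (Finset.abs_sum_le_sum_abs _ _).trans ((Finset.sum_le_sum (g := fun _ => (R d : ℝ))
          fun i _ => ?_).trans ?_)
        · rw [abs_mul, abs_of_nonneg (hκ.le.trans (hqκ i _))]
          exact (mul_le_of_le_one_right (abs_nonneg _) (hqs i _)).trans (by exact_mod_cast hv i d)
        · rw [Finset.sum_const, nsmul_eq_mul]
          exact mul_le_mul_of_nonneg_right hPr (hRr d).le
      have h₃ : |(x₀ d : ℝ)| ≤ Γ * R d :=
        (show |(x₀ d : ℝ)| ≤ P.card * R d by exact_mod_cast hx₀ d).trans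
          (mul_le_mul_of_nonneg_right hPr (hRr d).le)
      have h₄ := mul_le_mul_of_nonneg_right hZ (hRr d).le
      have h₅ : 0 ≤ (L : ℝ) / 2 * R d := mul_nonneg (by positivity) (hRr d).le
      rw [abs_le] at *
      constructor <;> linarith)
  have hq'0 := tilt_nonneg hqκ fun i => (htτ i).trans hτκ
  have hq' := sum_tilt hq t
  have hgood := half_le_smeas_near_target hR hv hext hl (w := w) hq'0 hq'
    (sum_tilt_fst hp1 t) (sum_tilt_snd hp2 t) (fun d => by
      have h₁ : ∑ i ∈ P, t i * v i d = 0 :=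
        Finset.sum_eq_zero fun i hi => by rw [htP i hi, zero_mul]
      have h₂ := ht d
      rw [← Finset.sum_add_sum_compl P, h₁, zero_add] at h₂
      simp only [tilt, if_true, mul_add, Finset.sum_add_distrib]
      simp only [mul_comm (v _ d : ℝ) (t _), h₂]
      ring) hlam0 hlam1 hlam hfA hfB hf
  have hfin := smeas_neighbourhood_le hκ hx hx1 hqκ hq'0 hq' (tilt_le q htτ) hτ
    {r : Fin n → Bool × Bool | (fun i => (r i).1) ∈ A₀ ∧ (fun i => (r i).2) ∈ A₀ ∧
      ∀ d, arrEval (capArr v) r d = w d} _ (2 * h + P.card) fun _ => Set.mem_ofPred_eq.mp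
  refine le_trans ?_ hfin
  have hpw : x ^ (2 * h + Γ) ≤ x ^ (2 * h + P.card) :=
    pow_le_pow_of_le_one hx.le hx1 (by lia)
  exact mul_le_mul hgood hpw (by positivity) (by linarith)

/-! ### Choice of constants -/

lemma abs_le_of_rnorm_le {D : ℕ} {R v : Fin D → ℝ} {m : ℝ} (hR : ∀ d, 0 < R d)
    (h : rnorm R v ≤ m) (d : Fin D) : |v d| ≤ m * R d := by
  rw [← div_le_iff₀ (hR d)]
  exact (le_ciSup (f := fun d => |v d| / R d) (Set.finite_range _).bddAbove d).trans h

lemma rnorm_le_one {D : ℕ} {R v : Fin D → ℝ} (hR : ∀ d, 0 < R d) (h : ∀ d, |v d| ≤ R d) :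
    rnorm R v ≤ 1 :=
  Real.iSup_le (fun d => (div_le_one (hR d)).2 (h d)) zero_le_one

lemma one_add_pow_le {η : ℝ} (h0 : 0 ≤ η) (h1 : η ≤ 1) (k : ℕ) :
    (1 + η) ^ k ≤ 1 + 2 ^ k * η := by
  induction k with
  | zero => simpa using h0
  | succ k ih =>
    have h : (1 + η) ^ k ≤ 2 ^ k := pow_le_pow_left₀ (by linarith) (by linarith) k
    have := mul_le_mul_of_nonneg_left h h0
    rw [pow_succ, pow_succ]
    linarith

lemma growth_rate_bounds {k : ℕ} {κ η : ℝ} (hκ : 0 < κ) (hκ1 : κ ≤ 1) (hη : 0 < η)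
    (hη1 : η ≤ 1) (h : 8 * (2 / κ) ^ k * η ≤ 1 / 2) :
    ((1 + η) ^ k - 1) / κ ^ k ≤ 1 / 8 ∧
      1 - 8 * (2 / κ) ^ k * η ≤ (1 - 7 * (((1 + η) ^ k - 1) / κ ^ k)) / (1 + η) ^ k ∧
      (1 - 7 * (((1 + η) ^ k - 1) / κ ^ k)) / (1 + η) ^ k ≤ 1 := by
  set E := (1 + η) ^ k - 1 with hE
  set β := E / κ ^ k with hβ
  have hκk : 0 < κ ^ k := pow_pos hκ k
  have hE0 : 0 ≤ E := sub_nonneg.2 (one_le_pow₀ (by linarith))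
  have hβ0 : 0 ≤ β := div_nonneg hE0 hκk.le
  have hEβ : E ≤ β := le_div_self hE0 hκk (pow_le_one₀ hκ.le hκ1)
  have hb : β ≤ (2 / κ) ^ k * η := by
    rw [hβ, div_pow, div_mul_eq_mul_div]
    exact div_le_div_of_nonneg_right (by linarith [one_add_pow_le hη.le hη1 k]) hκk.le
  have hpow : (1 + η) ^ k = 1 + E := by rw [hE]; ring
  rw [hpow]
  refine ⟨by linarith, ?_, ?_⟩
  · rw [le_div_iff₀ (by linarith)]
    nlinarith [mul_nonneg hE0 hβ0]
  · rw [div_le_one (by linarith)]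
    linarith

lemma exp_neg_two_mul_le {x : ℝ} (h0 : 0 ≤ x) (h1 : x ≤ 1 / 2) :
    Real.exp (-(2 * x)) ≤ 1 - x := by
  rw [Real.exp_neg, inv_le_comm₀ (Real.exp_pos _) (by linarith)]
  refine le_trans ?_ (Real.add_one_le_exp _)
  rw [inv_le_iff_one_le_mul₀ (by linarith)]
  nlinarith

lemma exp_half_le_one_add {x : ℝ} (h0 : 0 ≤ x) (h1 : x ≤ 1) : Real.exp (x / 2) ≤ 1 + x := by
  have h := Real.add_one_le_exp (-(x / 2))
  rw [Real.exp_neg, le_inv_comm₀ (by linarith) (Real.exp_pos _)] at h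
  refine h.trans ?_
  rw [inv_le_iff_one_le_mul₀ (by linarith)]
  nlinarith

lemma half_le_floor {y : ℝ} (hy : 2 ≤ y) : y / 2 ≤ ⌊y⌋₊ := by
  linarith [Nat.lt_floor_add_one y]

lemma eventually_le_mul_natCast (a : ℝ) {b : ℝ} (hb : 0 < b) :
    ∀ᶠ n : ℕ in Filter.atTop, a ≤ b * n :=
  (tendsto_natCast_atTop_atTop.const_mul_atTop hb).eventually_ge_atTop a

lemma eventually_mul_exp_neg_lt (a : ℝ) {b c : ℝ} (hb : 0 < b) (hc : 0 < c) :
    ∀ᶠ n : ℕ in Filter.atTop, a * Real.exp (-(b * n)) < c := by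
  have h : Filter.Tendsto (fun n : ℕ => a * Real.exp (-(b * n))) Filter.atTop (nhds (a * 0)) :=
    (Real.tendsto_exp_neg_atTop_nhds_zero.comp
      (tendsto_natCast_atTop_atTop.const_mul_atTop hb)).const_mul a
  rw [mul_zero] at h
  exact h.eventually_lt_const hc

lemma eventually_pow_le_two_pow_floor (C : ℕ) {α : ℝ} (hα : 0 < α) :
    ∀ᶠ n : ℕ in Filter.atTop, (n : ℝ) ^ C ≤ 2 ^ ⌊α * n⌋₊ := by
  have hb : 0 < α * Real.log 2 := mul_pos hα (Real.log_pos one_lt_two)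
  have h := ((isLittleO_pow_exp_pos_mul_atTop C hb).comp_tendsto
    tendsto_natCast_atTop_atTop).def (c := 1 / 2) (by norm_num)
  filter_upwards [h] with n hn
  simp only [Function.comp_apply, Real.norm_eq_abs, Real.abs_exp] at hn
  refine (le_abs_self _).trans (hn.trans ?_)
  have h₂ : (2 : ℝ) ^ ⌊α * n⌋₊ = Real.exp (Real.log 2 * ⌊α * n⌋₊) := by
    rw [Real.exp_mul, Real.exp_log two_pos, Real.rpow_natCast]
  have h₃ : (1 / 2 : ℝ) = Real.exp (-Real.log 2) := by
    rw [Real.exp_neg, Real.exp_log two_pos, one_div]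
  rw [h₂, h₃, ← Real.exp_add, Real.exp_le_exp]
  have := Nat.lt_floor_add_one (α * n)
  nlinarith [Real.log_pos one_lt_two]

lemma eventually_mul_le_nhdsGT (a : ℝ) {b : ℝ} (hb : 0 < b) :
    ∀ᶠ x in nhdsWithin (0 : ℝ) (Set.Ioi 0), x * a ≤ b := by
  have h : Filter.Tendsto (fun x : ℝ => x * a) (nhds 0) (nhds (0 * a)) :=
    (continuous_id.mul continuous_const).tendsto 0
  rw [zero_mul] at h
  exact (h.mono_left nhdsWithin_le_nhds).eventually_le_const hb

lemma one_le_growth {n M Γ : ℕ} {δ η ρ e : ℝ} (hδ : 0 ≤ δ) (hδ1 : δ ≤ 1 / 2) (hη : 0 ≤ η)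
    (hη1 : η ≤ 1) (he : 0 ≤ e) (he1 : e ≤ 1 / 2) (hρ : 1 - e ≤ ρ)
    (h : 4 * δ * n + 2 * e * M ≤ η / 2 * Γ) :
    1 ≤ (1 - δ) ^ n * (1 - δ) ^ n * ρ ^ M * (1 + η) ^ Γ := by
  have h₁ : Real.exp (-(2 * δ)) ^ n ≤ (1 - δ) ^ n :=
    pow_le_pow_left₀ (Real.exp_pos _).le (exp_neg_two_mul_le hδ hδ1) n
  have h₂ : Real.exp (-(2 * e)) ^ M ≤ ρ ^ M :=
    pow_le_pow_left₀ (Real.exp_pos _).le ((exp_neg_two_mul_le he he1).trans hρ) M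
  have h₃ : Real.exp (η / 2) ^ Γ ≤ (1 + η) ^ Γ :=
    pow_le_pow_left₀ (Real.exp_pos _).le (exp_half_le_one_add hη hη1) Γ
  have hδ0 : 0 ≤ (1 - δ) ^ n := pow_nonneg (by linarith) n
  have hρ0 : 0 ≤ ρ ^ M := pow_nonneg (by linarith) M
  calc (1 : ℝ) ≤ Real.exp (-(2 * δ)) ^ n * Real.exp (-(2 * δ)) ^ n * Real.exp (-(2 * e)) ^ M *
        Real.exp (η / 2) ^ Γ := by
        rw [← Real.exp_nat_mul, ← Real.exp_nat_mul, ← Real.exp_nat_mul, ← Real.exp_add,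
          ← Real.exp_add, ← Real.exp_add]
        exact Real.one_le_exp (by linarith)
    _ ≤ _ := by gcongr

lemma failure_probability_le {n D Γ h : ℕ} {α η c : ℝ} (hα : 0 ≤ α) (hη : 0 ≤ η)
    (hΓ : Γ ≤ c * α * n) (hηc : η * c ≤ α / 2048) (hh : α / 16 * n / 2 ≤ h)
    (hn : (2 + 2 * D) * Real.exp (-(α ^ 2 / 2048 * n)) ≤ 1 / 2) :
    2 * ((1 + η) ^ Γ * Real.exp (-(α / 16 * h) + (α / 16) ^ 2 / 4 * n)) +
      D * (2 * Real.exp (-((α / 8) ^ 2 / 16 * n))) ≤ 1 / 2 := by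
  have hn0 : (0 : ℝ) ≤ n := n.cast_nonneg
  have h₁ : (1 + η) ^ Γ ≤ Real.exp (α ^ 2 / 2048 * n) := by
    calc (1 + η) ^ Γ ≤ Real.exp η ^ Γ :=
          pow_le_pow_left₀ (by linarith) (by linarith [Real.add_one_le_exp η]) Γ
      _ = Real.exp (Γ * η) := (Real.exp_nat_mul _ _).symm
      _ ≤ _ := Real.exp_le_exp.2 (by
        have h₁ := mul_le_mul_of_nonneg_right hΓ hη
        have h₂ := mul_le_mul_of_nonneg_right hηc (mul_nonneg hα hn0)
        linarith)
  have h₂ : (1 + η) ^ Γ * Real.exp (-(α / 16 * h) + (α / 16) ^ 2 / 4 * n) ≤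
      Real.exp (-(α ^ 2 / 2048 * n)) := by
    refine (mul_le_mul_of_nonneg_right h₁ (Real.exp_pos _).le).trans ?_
    rw [← Real.exp_add, Real.exp_le_exp]
    have := mul_le_mul_of_nonneg_left hh hα
    linarith
  have h₃ : Real.exp (-((α / 8) ^ 2 / 16 * n)) ≤ Real.exp (-(α ^ 2 / 2048 * n)) := by
    rw [Real.exp_le_exp]
    have : 0 ≤ α ^ 2 * n := by positivity
    linarith
  have h₄ := mul_le_mul_of_nonneg_left h₃ (Nat.cast_nonneg (α := ℝ) D)
  linarith

lemma pow_lt_of_half_mul_pow_le {n N : ℕ} {ε x u S : ℝ} (hε1 : ε ≤ 1) (hx : 0 < x)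
    (hN : N * -Real.log x ≤ ε / 4 * n) (hu : 0 ≤ u) (huε : u ≤ ε / 4)
    (hn : 2 * Real.exp (-(ε / 2 * n)) < 1) (h : 1 / 2 * x ^ N ≤ (1 + u) ^ n * S) :
    (1 - ε) ^ n < S := by
  have h₁ : (1 - ε) ^ n ≤ Real.exp (-(ε * n)) := by
    calc (1 - ε) ^ n ≤ Real.exp (-ε) ^ n :=
          pow_le_pow_left₀ (by linarith) (Real.one_sub_le_exp_neg ε) n
      _ = Real.exp (-(ε * n)) := by rw [← Real.exp_nat_mul]; ring_nf
  have h₂ : Real.exp (-(ε / 4 * n)) ≤ x ^ N := by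
    rw [← Real.exp_log (pow_pos hx N), Real.exp_le_exp, Real.log_pow]
    linarith
  have h₃ : (1 + u) ^ n ≤ Real.exp (ε / 4 * n) := by
    calc (1 + u) ^ n ≤ Real.exp (ε / 4) ^ n :=
          pow_le_pow_left₀ (by linarith) (by linarith [Real.add_one_le_exp (ε / 4)]) n
      _ = Real.exp (ε / 4 * n) := by rw [← Real.exp_nat_mul]; ring_nf
  have hS : 0 ≤ S := by
    by_contra! hS
    have := mul_neg_of_pos_of_neg (pow_pos (by linarith : 0 < 1 + u) n) hS
    linarith [pow_pos hx N]
  have h₄ := mul_le_mul_of_nonneg_right h₃ hS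
  have e₁ : Real.exp (-(ε / 4 * n)) = Real.exp (ε / 4 * n) * Real.exp (-(ε / 2 * n)) := by
    rw [← Real.exp_add]; ring_nf
  have e₂ : Real.exp (-(ε * n)) = Real.exp (-(ε / 2 * n)) * Real.exp (-(ε / 2 * n)) := by
    rw [← Real.exp_add]; ring_nf
  have h₅ : 1 / 2 * Real.exp (-(ε / 2 * n)) ≤ S := by
    refine le_of_mul_le_mul_left ?_ (Real.exp_pos (ε / 4 * n))
    linarith
  have h₆ := mul_lt_mul_of_pos_right hn (Real.exp_pos (-(ε / 2 * n)))
  linarith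

set_option maxHeartbeats 1000000 in
/-- **Probabilistic forbidden intersection theorem.** -/
theorem probabilistic_forbidden_intersections (D C k : ℕ) :
    ∃ θ₁ > (0:ℝ), ∀ κ ∈ Set.Ioo (0:ℝ) θ₁, ∀ γ ∈ Set.Ioo (0:ℝ) θ₁, ∀ ε ∈ Set.Ioo (0:ℝ) θ₁,
    ∃ θ₂ > (0:ℝ), ∀ ζ ∈ Set.Ioo (0:ℝ) θ₂,
    ∃ δ₀ > (0:ℝ), ∃ n₀ : ℕ, ∀ n, n₀ ≤ n → ∀ δ ∈ Set.Ioc (0:ℝ) δ₀,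
    ∀ R : Fin D → ℤ, (∀ d, 0 < R d) → (∀ d, (R d : ℝ) < (n : ℝ) ^ C) →
    ∀ q : Fin n → Bool × Bool → ℝ,
      (∀ i, ∑ jj : Bool × Bool, q i jj = 1) →
      (∀ i jj, q i jj ∈ Set.Icc κ (1 - κ)) →
    ∀ p : Fin n → Bool → ℝ,
      (∀ i j, ∑ j' : Bool, q i (j, j') = p i j) →
      (∀ i j, ∑ j' : Bool, q i (j', j) = p i j) →
    ∀ v : Fin n → Fin D → ℤ,
      (∀ i, rnorm (fun d => (R d : ℝ)) (fun d => (v i d : ℝ)) ≤ 1) →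
      RobustlyGenerating γ (fun d => (R d : ℝ)) k v →
    ∀ w : Fin D → ℤ,
      rnorm (fun d => (R d : ℝ))
        (fun d => (w d : ℝ) - arrExp (capArr v) (prodMeas q) d) < ζ * n →
    ∀ A : Set (Fin n → Bool),
      (1 - δ) ^ n < smeas (prodMeas p) A →
      (1 - ε) ^ n <
        smeas (prodMeas q)
          {r : Fin n → Bool × Bool | (fun i => (r i).1) ∈ A ∧ (fun i => (r i).2) ∈ A ∧
            ∀ d, arrEval (capArr v) r d = w d} := by
  have hev : ∀ x : ℝ, 0 < x → ∀ᶠ y in nhdsWithin (0 : ℝ) (Set.Ioi 0), y ≤ x := fun x hx => by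
    simpa using eventually_mul_le_nhdsGT 1 hx
  refine ⟨1 / 2, by norm_num, fun κ hκ γ hγ ε hε => ?_⟩
  obtain ⟨hκ, hκ1⟩ := hκ
  obtain ⟨hγ, -⟩ := hγ
  obtain ⟨hε, hε1⟩ := hε
  -- the constants
  obtain ⟨K, hK⟩ : ∃ y : ℝ, y = ((k + 1 : ℕ) : ℝ) * ((D + 1 : ℕ) : ℝ) := ⟨_, rfl⟩
  have hK0 : 0 < K := by rw [hK]; positivity
  obtain ⟨C₁, hC₁⟩ : ∃ y : ℝ, y = 8 * (2 / κ) ^ k := ⟨_, rfl⟩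
  have hC₁0 : 0 < C₁ := by rw [hC₁]; positivity
  obtain ⟨c, hc⟩ : ∃ y : ℝ, y = 32 * C₁ * (D + 1) := ⟨_, rfl⟩
  have hc0 : 0 < c := by rw [hc]; positivity
  obtain ⟨cτ, hcτ⟩ : ∃ y : ℝ, y = (2 + 2 * c) * (4 * K / γ) := ⟨_, rfl⟩
  have hcτ0 : 0 < cτ := by rw [hcτ]; positivity
  obtain ⟨x, hx⟩ : ∃ y : ℝ, y = κ * ε / 8 := ⟨_, rfl⟩
  have hx0 : 0 < x := by rw [hx]; positivity
  have hx1 : x < 1 := by rw [hx]; nlinarith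
  have hlog : Real.log x < 0 := Real.log_neg hx0 hx1
  obtain ⟨α, ⟨⟨⟨hα1, hαγ⟩, hατ⟩, hαx⟩, hα⟩ := ((((hev 1 one_pos).and
    (eventually_mul_le_nhdsGT c (half_pos hγ))).and (eventually_mul_le_nhdsGT cτ hx0)).and
    (eventually_mul_le_nhdsGT ((1 / 8 + c) * -Real.log x) (show 0 < ε / 4 by positivity))
    |>.and self_mem_nhdsWithin).exists
  replace hα : 0 < α := hα
  obtain ⟨η, ⟨⟨hη1, hηC⟩, hηc⟩, hη⟩ := (((hev 1 one_pos).and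
    (eventually_mul_le_nhdsGT C₁ (show (0 : ℝ) < 1 / 2 by norm_num))).and
    (eventually_mul_le_nhdsGT c (show 0 < α / 2048 by positivity))
    |>.and self_mem_nhdsWithin).exists
  replace hη : 0 < η := hη
  obtain ⟨hβ, hρ0, hρ1⟩ := growth_rate_bounds (k := k) hκ (by linarith) hη hη1
    (by rw [← hC₁]; linarith)
  rw [← hC₁] at hρ0
  obtain ⟨ρ, hρ⟩ : ∃ y : ℝ, y = (1 - 7 * (((1 + η) ^ k - 1) / κ ^ k)) / (1 + η) ^ k := ⟨_, rfl⟩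
  rw [← hρ] at hρ0 hρ1
  have hρhalf : 1 / 2 ≤ ρ := by linarith
  refine ⟨α, hα, fun ζ hζ => ⟨min (1 / 2) (C₁ * (D + 1) * η * α), by positivity, ?_⟩⟩
  obtain ⟨hζ, hζα⟩ := hζ
  obtain ⟨n₀, hn₀⟩ := Filter.eventually_atTop.1
    ((((eventually_pow_le_two_pow_floor C hα).and
      (eventually_mul_exp_neg_lt (2 + 2 * D) (show 0 < α ^ 2 / 2048 by positivity)
        (show (0 : ℝ) < 1 / 2 by norm_num))).and
      ((eventually_mul_exp_neg_lt 2 (show 0 < ε / 2 by positivity) one_pos).and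
        (eventually_le_mul_natCast 32 hα))).and
      ((eventually_le_mul_natCast 2 (mul_pos hc0 hα)).and
        (eventually_le_mul_natCast 2 (show 0 < γ / (2 * K) by positivity))))
  refine ⟨n₀, fun n hn δ hδ R hR hRC q hq hqκ p hp1 hp2 v hv hgen w hw A hA => ?_⟩
  obtain ⟨⟨⟨hnC, hnD⟩, hnε, hnα⟩, hnc, hnK⟩ := hn₀ n hn
  obtain ⟨hδ, hδ₀⟩ := hδ
  have hδhalf := hδ₀.trans (min_le_left _ _)
  have hδη := hδ₀.trans (min_le_right _ _)
  have hRr : ∀ d, (0 : ℝ) < R d := fun d => by exact_mod_cast hR d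
  have hn0 : (0 : ℝ) ≤ n := n.cast_nonneg
  obtain ⟨L, hL⟩ : ∃ y, y = ⌊α * n⌋₊ := ⟨_, rfl⟩
  obtain ⟨Γ, hΓ⟩ : ∃ y, y = ⌊c * α * n⌋₊ := ⟨_, rfl⟩
  obtain ⟨m, hm⟩ : ∃ y, y = ⌊γ / (2 * K) * n⌋₊ := ⟨_, rfl⟩
  obtain ⟨h, hh⟩ : ∃ y, y = ⌊α / 16 * n⌋₊ := ⟨_, rfl⟩
  have hL1 : (L : ℝ) ≤ α * n := by
    rw [hL]; exact Nat.floor_le (by positivity)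
  have hL2 : α * n / 2 ≤ L := by
    rw [hL]; exact half_le_floor (by linarith)
  have hΓ1 : (Γ : ℝ) ≤ c * α * n := by
    rw [hΓ]; exact Nat.floor_le (by positivity)
  have hΓ2 : c * α * n / 2 ≤ Γ := by
    rw [hΓ]; exact half_le_floor hnc
  have hm1 : (m : ℝ) ≤ γ / (2 * K) * n := by
    rw [hm]; exact Nat.floor_le (by positivity)
  have hm2 : γ / (2 * K) * n / 2 ≤ m := by
    rw [hm]; exact half_le_floor hnK
  have hh1 : (h : ℝ) ≤ α / 16 * n := by
    rw [hh]; exact Nat.floor_le (by positivity)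
  have hh2 : α / 16 * n / 2 ≤ h := by
    rw [hh]; exact half_le_floor (by linarith)
  have hF0 : 0 < (1 - δ) ^ n := pow_pos (by linarith) n
  have hαγn : c * α * n ≤ γ / 2 * n := mul_le_mul_of_nonneg_right (by linarith) hn0
  have main := half_mul_pow_le_smeas_target (L := L) (Γ := Γ) (Γ' := ⌊γ * n⌋₊) (m := m) (h := h)
    (k := k) (κ := κ) (η := η) (ρ := ρ) (A₀ := A) (F := (1 - δ) ^ n * (1 - δ) ^ n) (w := w)
    (Z := ζ * n) (τ := cτ * α) (x := x) (lam := α / 8) (s := α / 16) (p := p) (q := q) (v := v)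
    hR (fun d => by rw [hL]; exact_mod_cast (hRC d).trans_le hnC)
    (fun i d => by
      have := abs_le_of_rnorm_le hRr (hv i) d
      rw [one_mul] at this
      exact_mod_cast this)
    hκ (by linarith) (fun i jj => (hqκ i jj).1) hq hp1 hp2
    (fun u hu T hT => hgen u (rnorm_le_one hRr fun d => by exact_mod_cast hu d) T
      ((Nat.le_floor_iff (by positivity)).1 hT))
    hη hβ (by rw [hρ]; exact div_mul_cancel₀ _ (by positivity)) (by linarith) hρ1 (mul_pos hF0 hF0)
    (mul_self_le_mul_self hF0.le hA.le)
    ?_ (fun d => abs_le_of_rnorm_le hRr hw.le d)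
    ?_ ?_ ?_ (by positivity) (by nlinarith) hx0 hx1.le (by positivity) (by linarith)
    (by positivity) (by linarith) ?_
  · refine pow_lt_of_half_mul_pow_le (by linarith) hx0 ?_ (by positivity) ?_ hnε main
    · have i₁ : ((2 * h + Γ : ℕ) : ℝ) ≤ (1 / 8 + c) * (α * n) := by
        push_cast; linarith
      have i₂ := mul_le_mul_of_nonneg_right i₁ (neg_nonneg.2 hlog.le)
      have i₃ := mul_le_mul_of_nonneg_right hαx hn0
      linarith
    · rw [div_le_iff₀ hκ, mul_comm cτ]
      linarith
  · refine one_le_growth hδ.le hδhalf hη.le hη1 (mul_nonneg hC₁0.le hη.le) (by linarith) hρ0 ?_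
    have hY : 0 ≤ C₁ * η * (α * n) := by positivity
    have hD : (0 : ℝ) ≤ D := D.cast_nonneg
    have i₁ := mul_le_mul_of_nonneg_right hδη hn0
    have i₂ := mul_le_mul_of_nonneg_left hL1 (show 0 ≤ C₁ * η * D by positivity)
    have i₃ := mul_le_mul_of_nonneg_left hΓ2 hη.le
    rw [hc] at i₃
    push_cast
    linarith
  · have : (0 : ℝ) < m := by linarith
    exact_mod_cast this
  · apply Nat.le_floor
    push_cast
    have i₁ : (k : ℝ) * (D * m) ≤ K * m := by
      rw [← mul_assoc, hK]
      push_cast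
      gcongr <;> linarith
    have i₂ := mul_le_mul_of_nonneg_left hm1 hK0.le
    have i₃ : K * (γ / (2 * K) * n) = γ / 2 * n := by field_simp
    linarith
  · have i₁ := mul_le_mul_of_nonneg_right hm2 (show 0 ≤ cτ * α by positivity)
    have i₂ : γ / (2 * K) * n / 2 * (cτ * α) = (2 + 2 * c) * (α * n) := by
      rw [hcτ]; field_simp; ring
    have i₃ := mul_le_mul_of_nonneg_right hζα.le hn0
    have i₄ : 0 ≤ α * n := by positivity
    linarith
  · exact failure_probability_le hα.le hη.le hΓ1 hηc hh2 hnD.le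
end
end
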